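/- Let F be a free group of finite rank and A a nonabelian subgroup of F. Then dcl(A) is a free factor of acl(A). Similarly, dcl^∃(A) is a free factor of acl^∃(A). -/

import Mathlib

open FirstOrder Filter

/-! Common definitions: the first-order language of groups, algebraic/definable closures,
free products, amalgams, HNN extensions, etc. -/

/-- Function symbols of the language of groups: `1`, `⁻¹`, `·`. -/
inductive GrpFunc : ℕ → Type
  | one : GrpFunc 0
  | inv : GrpFunc 1
  | mul : GrpFunc 2

/-- The first-order language of groups `L = {·, ⁻¹, 1}` (no relation symbols). -/
def grpLang : FirstOrder.Language := ⟨GrpFunc, fun _ => Empty⟩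

/-- Every group is a `grpLang`-structure in the natural way. -/
instance grpStructure (G : Type*) [Group G] : grpLang.Structure G where
  funMap {_} f := match f with
    | .one => fun _ => (1 : G)
    | .inv => fun x => (x 0)⁻¹
    | .mul => fun x => x 0 * x 1
  RelMap {_} r := Empty.elim r

/-- A formula is existential if it is obtained from a quantifier-free formula by
prefixing existential quantifiers. -/
def IsExistential {L : FirstOrder.Language} {α : Type*} (φ : L.Formula α) : Prop :=
  ∃ (n : ℕ) (ψ : L.BoundedFormula α n), ψ.IsQF ∧ φ = ψ.exs

section ModelTheory

variable (L : FirstOrder.Language) {M : Type*} [L.Structure M]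

/-- The algebraic closure of a set of parameters `A` in an `L`-structure `M`:
elements satisfying, together with only finitely many other elements, some formula
with parameters from `A`. -/
def Lacl (A : Set M) : Set M :=
  {b | ∃ φ : L.Formula (↥A ⊕ Fin 1),
    {c : M | φ.Realize (Sum.elim Subtype.val fun _ => c)}.Finite ∧
    φ.Realize (Sum.elim Subtype.val fun _ => b)}

/-- The definable closure of a set of parameters `A` in an `L`-structure `M`. -/
def Ldcl (A : Set M) : Set M :=
  {b | ∃ φ : L.Formula (↥A ⊕ Fin 1),
    {c : M | φ.Realize (Sum.elim Subtype.val fun _ => c)} = {b}}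

/-- The existential algebraic closure of `A` in `M`. -/
def LaclE (A : Set M) : Set M :=
  {b | ∃ φ : L.Formula (↥A ⊕ Fin 1), IsExistential φ ∧
    {c : M | φ.Realize (Sum.elim Subtype.val fun _ => c)}.Finite ∧
    φ.Realize (Sum.elim Subtype.val fun _ => b)}

/-- The existential definable closure of `A` in `M`. -/
def LdclE (A : Set M) : Set M :=
  {b | ∃ φ : L.Formula (↥A ⊕ Fin 1), IsExistential φ ∧
    {c : M | φ.Realize (Sum.elim Subtype.val fun _ => c)} = {b}}

end ModelTheory

section GroupDefs

variable {G : Type*} [Group G]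

/-- Algebraic closure in a group, w.r.t. the language of groups. -/
def acl (A : Set G) : Set G := Lacl grpLang A

/-- Definable closure in a group, w.r.t. the language of groups. -/
def dcl (A : Set G) : Set G := Ldcl grpLang A

/-- Existential algebraic closure in a group. -/
def aclE (A : Set G) : Set G := LaclE grpLang A

/-- Existential definable closure in a group. -/
def dclE (A : Set G) : Set G := LdclE grpLang A

/-- Restricted algebraic closure: elements with finite orbit under automorphisms
of `G` fixing `A` pointwise. -/
def racl (A : Set G) : Set G :=
  {g | {x : G | ∃ f : G ≃* G, (∀ a ∈ A, f a = a) ∧ f g = x}.Finite}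

/-- Restricted definable closure: elements fixed by every automorphism of `G`
fixing `A` pointwise. -/
def rdcl (A : Set G) : Set G :=
  {g | ∀ f : G ≃* G, (∀ a ∈ A, f a = a) → f g = g}

/-- A set of group elements is nonabelian (contains two non-commuting elements). -/
def Nonabelian (A : Set G) : Prop := ∃ x ∈ A, ∃ y ∈ A, x * y ≠ y * x

/-- `F` is a free group of finite rank. -/
def IsFreeOfFiniteRank (F : Type*) [Group F] : Prop :=
  ∃ n : ℕ, Nonempty (F ≃* FreeGroup (Fin n))

/-- `G` is the internal free product of its subgroups `H` and `K`: the canonical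
homomorphism from the abstract free product `H ∗ K` to `G` is an isomorphism. -/
def InternalFreeProduct (H K : Subgroup G) : Prop :=
  Function.Bijective (Monoid.Coprod.lift H.subtype K.subtype)

/-- `G` is freely indecomposable relative to its subgroup `A`. -/
def FreelyIndecomposableRel (A : Subgroup G) : Prop :=
  ¬ ∃ G₁ G₂ : Subgroup G, G₁ ≠ ⊥ ∧ G₂ ≠ ⊥ ∧ A ≤ G₁ ∧ InternalFreeProduct G₁ G₂

/-- `B` is a free factor of the subgroup `K`: there is `L` such that the canonical
homomorphism from the abstract free product `B ∗ L` to the ambient group is injective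
with image exactly `K`. -/
def IsFreeFactorOf (B K : Subgroup G) : Prop :=
  ∃ L : Subgroup G,
    Function.Injective (Monoid.Coprod.lift B.subtype L.subtype) ∧
    (Monoid.Coprod.lift B.subtype L.subtype).range = K

/-- `K'` is the amalgamated free product `K ∗_C B` inside the ambient group `G`:
the canonical homomorphism from the abstract amalgamated product (pushout) of `K` and
`B` over `C` to `G` is injective with image exactly `K'`. -/
def IsAmalgamOf (K B C : Subgroup G) (hCK : C ≤ K) (hCB : C ≤ B) (K' : Subgroup G) : Prop :=
  ∃ ℓ : Monoid.PushoutI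
      (fun i : Bool =>
        (Subgroup.inclusion (show C ≤ cond i K B by cases i <;> assumption) :
          ↥C →* ↥(cond i K B))) →* G,
    (∀ i : Bool, ℓ.comp (Monoid.PushoutI.of i) = (cond i K B).subtype) ∧
    Function.Injective ℓ ∧ ℓ.range = K'

/-- `K'` is the HNN extension of `K` along `φ : C ≃* D` inside the ambient group `G`:
the canonical homomorphism from the abstract HNN extension of `K` along `φ` to `G` is
injective with image exactly `K'` (and is the inclusion on `K`). -/
def IsHNNOf (K : Subgroup G) {C D : Subgroup ↥K} (φ : ↥C ≃* ↥D) (K' : Subgroup G) : Prop :=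
  ∃ ℓ : HNNExtension ↥K C D φ →* G,
    ℓ.comp HNNExtension.of = K.subtype ∧ Function.Injective ℓ ∧ ℓ.range = K'

/-- One constructibility step: `K'` is an amalgamated free product of `K` with some
subgroup over a cyclic subgroup, or an HNN extension of `K` along an isomorphism of two
cyclic subgroups of `K`. -/
def ConstructStep (K K' : Subgroup G) : Prop :=
  (∃ (B C : Subgroup G) (hCK : C ≤ K) (hCB : C ≤ B),
      (∃ c : G, C = Subgroup.zpowers c) ∧ B ≤ K' ∧ K ≤ K' ∧ IsAmalgamOf K B C hCK hCB K')
  ∨ (∃ (C D : Subgroup ↥K) (φ : ↥C ≃* ↥D),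
      (∃ c : ↥K, C = Subgroup.zpowers c) ∧ (∃ d : ↥K, D = Subgroup.zpowers d) ∧ IsHNNOf K φ K')

/-- `B` is constructible from `A` by a finite sequence of amalgamated free products and
HNN-extensions along cyclic subgroups. -/
def ConstructibleFrom (A B : Subgroup G) : Prop := Relation.ReflTransGen ConstructStep A B

/-- The rank of a subgroup: the least cardinality of a generating set. For (subgroups of)
free groups this is the cardinality of a basis. -/
noncomputable def srank (H : Subgroup G) : Cardinal :=
  sInf {c : Cardinal | ∃ S : Set G, Subgroup.closure S = H ∧ c = Cardinal.mk ↥S}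

/-- `M` is a maximal abelian subgroup. -/
def IsMaxAbelian (M : Subgroup G) : Prop :=
  (∀ x ∈ M, ∀ y ∈ M, x * y = y * x) ∧
  ∀ N : Subgroup G, (∀ x ∈ N, ∀ y ∈ N, x * y = y * x) → M ≤ N → M = N

/-- `M` is a maximal abelian subgroup of the subgroup `H`. -/
def IsMaxAbelianIn (M H : Subgroup G) : Prop :=
  M ≤ H ∧ (∀ x ∈ M, ∀ y ∈ M, x * y = y * x) ∧
  ∀ N : Subgroup G, N ≤ H → (∀ x ∈ N, ∀ y ∈ N, x * y = y * x) → M ≤ N → M = N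

/-- `M` is a malnormal subgroup: `gMg⁻¹ ∩ M = 1` for every `g ∉ M`. -/
def Malnormal (M : Subgroup G) : Prop :=
  ∀ g : G, g ∉ M → ∀ x ∈ M, g * x * g⁻¹ ∈ M → x = 1

/-- A group is CSA if every maximal abelian subgroup is malnormal. -/
def IsCSA (G : Type*) [Group G] : Prop := ∀ M : Subgroup G, IsMaxAbelian M → Malnormal M

/-- Every abelian subgroup of `G` is cyclic. -/
def AbelianSubgroupsCyclic (G : Type*) [Group G] : Prop :=
  ∀ H : Subgroup G, (∀ x ∈ H, ∀ y ∈ H, x * y = y * x) → ∃ g : G, H = Subgroup.zpowers g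

/-- `G` is equationally noetherian: every system of equations over `G` in finitely many
variables is equivalent to a finite subsystem. -/
def EqNoetherian (G : Type*) [Group G] : Prop :=
  ∀ n : ℕ, 0 < n → ∀ S : Set (Monoid.Coprod G (FreeGroup (Fin n))),
    ∃ S₀ : Set (Monoid.Coprod G (FreeGroup (Fin n))), S₀ ⊆ S ∧ S₀.Finite ∧
      ∀ f : Monoid.Coprod G (FreeGroup (Fin n)) →* G,
        f.comp Monoid.Coprod.inl = MonoidHom.id G →
        ((∀ s ∈ S₀, f s = 1) ↔ ∀ s ∈ S, f s = 1)

/-- A group homomorphism is elementary w.r.t. the language of groups: it preserves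
and reflects all first-order formulas. -/
def ElementaryEmb {H K : Type*} [Group H] [Group K] (e : H →* K) : Prop :=
  ∀ (n : ℕ) (φ : grpLang.Formula (Fin n)) (v : Fin n → H),
    (φ.Realize fun i => e (v i)) ↔ φ.Realize v

/-- The inclusion of the subgroup `H` is an elementary embedding; i.e. the ambient group
is an elementary extension of `H`. -/
def ElementarySub (H : Subgroup G) : Prop := ElementaryEmb H.subtype

/-- A sequence of homomorphisms is stable. -/
def StableSeq {K H : Type*} [Group K] [Group H] (h : ℕ → (K →* H)) : Prop :=
  ∀ k : K, (∀ᶠ n in Filter.atTop, h n k = 1) ∨ (∀ᶠ n in Filter.atTop, h n k ≠ 1)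

/-- A sequence of homomorphisms has trivial stable kernel. -/
def TrivialStableKernel {K H : Type*} [Group K] [Group H] (h : ℕ → (K →* H)) : Prop :=
  ∀ k : K, (∀ᶠ n in Filter.atTop, h n k = 1) → k = 1

/-- A stable sequence of homomorphisms `g n : D → H` with trivial stable kernel strongly
converges to `D`, where `D` is a subgroup of an extension of the base group `H`, the base
group being embedded via `e`. -/
def StronglyConverges {H Gs : Type*} [Group H] [Group Gs] (e : H →* Gs)
    (D : Subgroup Gs) (g : ℕ → (↥D →* H)) : Prop :=
  StableSeq g ∧ TrivialStableKernel g ∧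
  (∀ (d : ↥D) (b : H), (d : Gs) = e b → ∀ᶠ n in Filter.atTop, g n d = b) ∧
  (∀ (d : ↥D) (b : H), (∃ᶠ n in Filter.atTop, g n d = b) → (d : Gs) = e b)

/-- The ball of radius `r` about the identity in the word metric w.r.t. `S`. -/
def wordBall (S : Set G) (r : ℕ) : Set G :=
  {g | ∃ l : List G, l.length ≤ r ∧ (∀ x ∈ l, x ∈ S ∨ x⁻¹ ∈ S) ∧ l.prod = g}

end GroupDefs

open scoped Pointwise

section PingPong

variable {G : Type*} [Group G]

/-- Alternating words in a free product whose values are controlled by a ping-pong set `U`. -/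
inductive PingPongWord (B R : Subgroup G) (U : Set G) : Monoid.Coprod B R → Prop
  | base (c : B) : PingPongWord B R U (Monoid.Coprod.inl c)
  | step (c : B) (h : R) (w : Monoid.Coprod B R) : h ≠ 1 → PingPongWord B R U w →
      Monoid.Coprod.lift B.subtype R.subtype w ∉ U →
      PingPongWord B R U (Monoid.Coprod.inl c * (Monoid.Coprod.inr h * w))

theorem injective_coprodLift_of_pingPong (B R : Subgroup G) (U : Set G)
    (hBU : ∀ c ∈ B, c ∉ U) (hB : ∀ c ∈ B, c ≠ 1 → ∀ x ∈ U, c * x ∉ U)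
    (hR : ∀ h ∈ R, h ≠ 1 → ∀ x ∉ U, h * x ∈ U) :
    Function.Injective (Monoid.Coprod.lift B.subtype R.subtype) := by
  have hinl : ∀ (c : B) w, PingPongWord B R U w →
      PingPongWord B R U (Monoid.Coprod.inl c * w) := by
    intro c w hw
    cases hw with
    | base d => rw [← map_mul]; exact .base _
    | step d h w hh hw hwU => rw [← mul_assoc, ← map_mul]; exact .step _ _ _ hh hw hwU
  have hinr : ∀ (k : R) w, PingPongWord B R U w →
      PingPongWord B R U (Monoid.Coprod.inr k * w) := by
    intro k w hw
    by_cases hk : k = 1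
    · simpa [hk] using hw
    have key : PingPongWord B R U w → Monoid.Coprod.lift B.subtype R.subtype w ∉ U →
        PingPongWord B R U (Monoid.Coprod.inr k * w) := by
      intro h1 h2
      simpa using PingPongWord.step 1 k w hk h1 h2
    cases hw with
    | base d => exact key (.base d) (by simpa using hBU d d.2)
    | step d h w hh hw hwU =>
      by_cases hd : d = 1
      · subst hd
        rw [map_one, one_mul, ← mul_assoc, ← map_mul]
        by_cases hkh : k * h = 1
        · simpa [hkh] using hw
        · simpa using PingPongWord.step 1 (k * h) w hkh hw hwU
      · refine key (.step d h w hh hw hwU) ?_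
        have := hB d d.2 (by simpa using hd) _ (hR h h.2 (by simpa using hh) _ hwU)
        simpa using this
  have hall : ∀ w, PingPongWord B R U w := by
    intro w
    induction w using Monoid.Coprod.induction_on' with
    | one => simpa using PingPongWord.base (R := R) (U := U) (1 : B)
    | inl_mul m x ih => exact hinl m x ih
    | inr_mul n x ih => exact hinr n x ih
  rw [injective_iff_map_eq_one]
  intro w hw1
  cases hall w with
  | base d =>
    have : d = 1 := by simpa using hw1
    simp [this]
  | step d h w hh hw hwU =>
    exfalso
    have h1 := hR h h.2 (by simpa using hh) _ hwU
    have h2 : (d : G) * (h * Monoid.Coprod.lift B.subtype R.subtype w) = 1 := by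
      simpa using hw1
    rw [eq_inv_of_mul_eq_one_right h2] at h1
    exact hBU _ (B.inv_mem d.2) h1

theorem IsFreeFactorOf.map {H : Type*} [Group H] (f : G →* H) (hf : Function.Injective f)
    {B K : Subgroup G} (h : IsFreeFactorOf B K) : IsFreeFactorOf (B.map f) (K.map f) := by
  obtain ⟨L, hi, hr⟩ := h
  refine ⟨L.map f, ?_⟩
  have hcomp : (Monoid.Coprod.lift (B.map f).subtype (L.map f).subtype).comp
      ((MulEquiv.coprodCongr (B.equivMapOfInjective f hf)
        (L.equivMapOfInjective f hf)).toMonoidHom) =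
      f.comp (Monoid.Coprod.lift B.subtype L.subtype) := by
    apply Monoid.Coprod.hom_ext <;> ext x <;> simp
  constructor
  · have h1 : Function.Injective ((Monoid.Coprod.lift (B.map f).subtype (L.map f).subtype).comp
      ((MulEquiv.coprodCongr (B.equivMapOfInjective f hf)
        (L.equivMapOfInjective f hf)).toMonoidHom)) := by
      rw [hcomp]; exact hf.comp hi
    intro x y hxy
    obtain ⟨x, rfl⟩ := (MulEquiv.coprodCongr (B.equivMapOfInjective f hf)
        (L.equivMapOfInjective f hf)).surjective x
    obtain ⟨y, rfl⟩ := (MulEquiv.coprodCongr (B.equivMapOfInjective f hf)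
        (L.equivMapOfInjective f hf)).surjective y
    exact congrArg _ (h1 hxy)
  · rw [Monoid.Coprod.range_lift] at hr ⊢
    simp only [Subgroup.range_subtype] at hr ⊢
    rw [← hr, Subgroup.map_sup]

theorem IsFreeFactorOf.refl (K : Subgroup G) : IsFreeFactorOf K K := by
  refine ⟨⊥, ?_, ?_⟩
  · refine injective_coprodLift_of_pingPong K ⊥ ∅ (by simp) (by simp) ?_
    intro h hh h1
    exact absurd (Subgroup.mem_bot.1 hh) h1
  · rw [Monoid.Coprod.range_lift]; simp

theorem IsFreeFactorOf.trans {B C K : Subgroup G} (h1 : IsFreeFactorOf B C)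
    (h2 : IsFreeFactorOf C K) : IsFreeFactorOf B K := by
  obtain ⟨L, hi, hr⟩ := h1
  obtain ⟨M, hi', hr'⟩ := h2
  let e : Monoid.Coprod B L ≃* C :=
    (MonoidHom.ofInjective hi).trans (MulEquiv.subgroupCongr hr)
  have he : ∀ x, (e x : G) = Monoid.Coprod.lift B.subtype L.subtype x := fun x => rfl
  let F1 : Monoid.Coprod B (Monoid.Coprod L M) →* G :=
    (Monoid.Coprod.lift C.subtype M.subtype).comp
      ((MulEquiv.coprodCongr e (MulEquiv.refl M)).toMonoidHom.comp
        (MulEquiv.coprodAssoc B L M).symm.toMonoidHom)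
  have hF1 : Function.Injective F1 :=
    hi'.comp ((MulEquiv.coprodCongr e (MulEquiv.refl M)).injective.comp
      (MulEquiv.coprodAssoc B L M).symm.injective)
  let j : Monoid.Coprod L M →* G := Monoid.Coprod.lift L.subtype M.subtype
  have hj : F1.comp Monoid.Coprod.inr = j := by
    apply Monoid.Coprod.hom_ext <;> ext x <;> simp [F1, j, he]
  have hj' : F1.comp Monoid.Coprod.inl = B.subtype := by
    ext x; simp [F1, he]
  have hji : Function.Injective j := by
    rw [← hj]
    exact hF1.comp Monoid.Coprod.inr_injective
  refine ⟨j.range, ?_, ?_⟩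
  · have hcomp : (Monoid.Coprod.lift B.subtype j.range.subtype).comp
        (MulEquiv.coprodCongr (MulEquiv.refl B) (MonoidHom.ofInjective hji)).toMonoidHom = F1 := by
      apply Monoid.Coprod.hom_ext
      · rw [hj']; ext x; simp
      · rw [hj]
        refine MonoidHom.ext fun x => ?_
        simp only [MonoidHom.comp_apply, MulEquiv.coe_toMonoidHom]
        exact MonoidHom.ofInjective_apply hji
    rw [← hcomp] at hF1
    intro x y hxy
    obtain ⟨x, rfl⟩ := (MulEquiv.coprodCongr (MulEquiv.refl B)
      (MonoidHom.ofInjective hji)).surjective x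
    obtain ⟨y, rfl⟩ := (MulEquiv.coprodCongr (MulEquiv.refl B)
      (MonoidHom.ofInjective hji)).surjective y
    exact congrArg _ (hF1 hxy)
  · rw [Monoid.Coprod.range_lift] at hr hr' ⊢
    simp only [Subgroup.range_subtype] at hr hr' ⊢
    simp only [j, Monoid.Coprod.range_lift, Subgroup.range_subtype]
    rw [← hr', ← hr, sup_assoc]

end PingPong

section NestedFamily

variable {G : Type*} [Group G]

/-- The elements of `G` which no member of the family `E` separates from `1`, for a
left-invariant family `E` of subsets. -/
def unseparated (E : Set (Set G)) (hL : ∀ k : G, ∀ e ∈ E, k • e ∈ E) : Subgroup G where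
  carrier := {g | ∀ e ∈ E, (1 ∈ e ↔ g ∈ e)}
  one_mem' := fun _ _ => Iff.rfl
  mul_mem' := by
    intro g h hg hh e he
    have h1 := hh _ (hL g⁻¹ e he)
    simp only [Set.mem_inv_smul_set_iff, smul_eq_mul, mul_one] at h1
    rw [hg e he, h1]
  inv_mem' := by
    intro g hg e he
    have h1 := hg _ (hL g e he)
    simp only [Set.mem_smul_set_iff_inv_smul_mem, smul_eq_mul, mul_one, inv_mul_cancel] at h1
    exact h1.symm

theorem mem_unseparated {E : Set (Set G)} {hL : ∀ k : G, ∀ e ∈ E, k • e ∈ E} {g : G} :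
    g ∈ unseparated E hL ↔ ∀ e ∈ E, (1 ∈ e ↔ g ∈ e) := Iff.rfl

theorem mul_mem_iff_of_unseparated {E : Set (Set G)} {hL : ∀ k : G, ∀ e ∈ E, k • e ∈ E} {c : G}
    (hc : c ∈ unseparated E hL) (x : G) {e : Set G} (he : e ∈ E) : x * c ∈ e ↔ x ∈ e := by
  have h1 := hc _ (hL x⁻¹ e he)
  simpa [Set.mem_inv_smul_set_iff] using h1.symm

/-- An almost right-invariant proper subset of a torsion-free group has trivial stabilizer. -/
theorem eq_one_of_smul_eq_of_almostInvariant (tf : ∀ (g : G) (n : ℕ), 0 < n → g ^ n = 1 → g = 1)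
    {e : Set G} (har : ∀ g : G, {x | ¬ (x ∈ e ↔ x * g ∈ e)}.Finite)
    {x y : G} (hx : x ∈ e) (hy : y ∉ e) {k : G} (hk : k • e = e) : k = 1 := by
  have hmem : ∀ z, k * z ∈ e ↔ z ∈ e := by
    intro z
    conv_lhs => rw [← hk]
    simp [Set.mem_smul_set_iff_inv_smul_mem]
  have hpow : ∀ n : ℕ, ∀ z, k ^ n * z ∈ e ↔ z ∈ e := by
    intro n
    induction n with
    | zero => simp
    | succ n ih => intro z; rw [pow_succ', mul_assoc, hmem, ih]
  have hin : ∀ n : ℕ, k ^ n * x ∈ {z | ¬ (z ∈ e ↔ z * (x⁻¹ * y) ∈ e)} := by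
    intro n
    simp only [Set.mem_ofPred_eq, mul_assoc, mul_inv_cancel_left, hpow]
    tauto
  by_contra hne
  have hinj : Function.Injective fun n : ℕ => k ^ n * x := by
    intro m n hmn
    simp only [mul_left_inj] at hmn
    wlog hlt : m < n generalizing m n
    · rcases lt_trichotomy m n with h | h | h
      · exact absurd h hlt
      · exact h
      · exact (this hmn.symm h).symm
    refine absurd (tf k (n - m) (by omega) ?_) hne
    have : k ^ m * k ^ (n - m) = k ^ m * 1 := by rw [← pow_add, mul_one, hmn]; congr 1; omega
    exact mul_left_cancel this
  exact Set.infinite_of_injective_forall_mem hinj hin (har _)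

theorem exists_freeComplement_unseparated
    (tf : ∀ (g : G) (n : ℕ), 0 < n → g ^ n = 1 → g = 1)
    (E : Set (Set G)) (hL : ∀ k : G, ∀ e ∈ E, k • e ∈ E) (hc : ∀ e ∈ E, eᶜ ∈ E)
    (hn : ∀ e ∈ E, ∀ f ∈ E, e ⊆ fᶜ ∨ e ⊆ f ∨ f ⊆ e ∨ eᶜ ⊆ f)
    (har : ∀ e ∈ E, ∀ g : G, {x | ¬ (x ∈ e ↔ x * g ∈ e)}.Finite)
    (hfin : ∀ g : G, {e ∈ E | 1 ∉ e ∧ g ∈ e}.Finite) :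
    IsFreeFactorOf (unseparated E hL) ⊤ := by
  classical
  set C := unseparated E hL with hC
  let A : Set (Set G) := {e | e ∈ E ∧ e.Nonempty ∧ 1 ∉ e ∧
    ∀ f ∈ E, 1 ∉ f → e ⊆ f → e = f}
  have hsm : ∀ (k x : G) (e : Set G), x ∈ k • e ↔ k⁻¹ * x ∈ e := by
    intro k x e; rw [Set.mem_smul_set_iff_inv_smul_mem, smul_eq_mul]
  have hmax : ∀ e ∈ E, 1 ∉ e → ∀ g ∈ e, ∃ f ∈ A, e ⊆ f := by
    intro e he h1 g hg
    obtain ⟨m, hem, hm⟩ := (hfin g).exists_le_maximal ⟨he, h1, hg⟩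
    refine ⟨m, ⟨hm.1.1, ⟨g, hm.1.2.2⟩, hm.1.2.1, fun f hf h1f hmf => ?_⟩, hem⟩
    exact subset_antisymm hmf (hm.2 ⟨hf, h1f, hmf hm.1.2.2⟩ hmf)
  have hdisj : ∀ e ∈ A, ∀ f ∈ A, ∀ x, x ∈ e → x ∈ f → e = f := by
    intro e he f hf x hxe hxf
    rcases hn e he.1 f hf.1 with h | h | h | h
    · exact absurd hxf (h hxe)
    · exact he.2.2.2 f hf.1 hf.2.2.1 h
    · exact (hf.2.2.2 e he.1 he.2.2.1 h).symm
    · exact absurd (h he.2.2.1) hf.2.2.1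
  have hCA : ∀ c ∈ C, ∀ e ∈ A, c • e ∈ A := by
    intro c hc e he
    have key : ∀ d ∈ C, ∀ f ∈ E, 1 ∉ f → 1 ∉ d • f := by
      intro d hd f hf h1 h2
      rw [hsm, mul_one] at h2
      exact h1 ((C.inv_mem hd f hf).2 h2)
    refine ⟨hL c e he.1, he.2.1.smul_set, key c hc e he.1 he.2.2.1, fun f hf h1f hcf => ?_⟩
    have := he.2.2.2 (c⁻¹ • f) (hL _ _ hf) (key _ (C.inv_mem hc) f hf h1f)
      (by rwa [← Set.smul_set_subset_iff_subset_inv_smul_set])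
    rw [this, smul_inv_smul]
  let A' : Set (Set G) := {e | e ∈ A ∧ (Quotient.mk (MulAction.orbitRel C (Set G)) e).out = e}
  let U : Set G := ⋃₀ A'
  have hUC : ∀ c ∈ C, c ∉ U := by
    rintro c hc ⟨e, he, hce⟩
    exact he.1.2.2.1 ((hc e he.1.1).2 hce)
  have hUr : ∀ c ∈ C, ∀ x, x * c ∈ U ↔ x ∈ U := by
    intro c hc x
    simp only [U, Set.mem_sUnion]
    constructor <;> rintro ⟨e, he, hx⟩ <;> refine ⟨e, he, ?_⟩
    · rwa [← mul_mem_iff_of_unseparated hc x he.1.1]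
    · rwa [mul_mem_iff_of_unseparated hc x he.1.1]
  have hcov : ∀ x ∉ C, ∃ c ∈ C, c * x ∈ U := by
    intro x hx
    have : ∃ e ∈ E, 1 ∉ e ∧ x ∈ e := by
      by_contra! hcon
      refine hx fun e he => ⟨fun h1 => ?_, fun h2 => ?_⟩
      · by_contra h2
        exact hcon eᶜ (hc e he) (by simpa using h1) h2
      · by_contra h1
        exact hcon e he h1 h2
    obtain ⟨e, he, h1, hxe⟩ := this
    obtain ⟨f, hf, hef⟩ := hmax e he h1 x hxe
    have hrel : (MulAction.orbitRel C (Set G)).r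
      (Quotient.mk (MulAction.orbitRel C (Set G)) f).out f := Quotient.mk_out f
    obtain ⟨c, hc⟩ := hrel
    have hc' : (c : G) • f = (Quotient.mk (MulAction.orbitRel C (Set G)) f).out := hc
    refine ⟨c, c.2, (c : G) • f, ⟨hCA c c.2 f hf, ?_⟩, ?_⟩
    · have : Quotient.mk (MulAction.orbitRel C (Set G)) ((c : G) • f) =
        Quotient.mk (MulAction.orbitRel C (Set G)) f := Quotient.sound ⟨c, rfl⟩
      rw [this, hc']
    · rw [hsm, inv_mul_cancel_left]; exact hef hxe
  have hdis : ∀ e ∈ A', ∀ f ∈ A', ∀ c ∈ C, ∀ x ∈ e, c * x ∈ f → c = 1 := by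
    intro e he f hf c hc x hx hcx
    have h1 : c • e = f := hdisj _ (hCA c hc e he.1) f hf.1 (c * x)
      (by rw [hsm, inv_mul_cancel_left]; exact hx) hcx
    have h2 : Quotient.mk (MulAction.orbitRel C (Set G)) f =
        Quotient.mk (MulAction.orbitRel C (Set G)) e := Quotient.sound ⟨⟨c, hc⟩, h1⟩
    have h3 : e = f := by rw [← he.2, ← hf.2, h2]
    rw [← h3] at h1
    exact eq_one_of_smul_eq_of_almostInvariant tf (har e he.1.1) hx he.1.2.2.1 h1
  have hUU : ∀ c ∈ C, ∀ x ∈ U, c * x ∈ U → c = 1 := by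
    rintro c hc x ⟨e, he, hx⟩ ⟨f, hf, hcx⟩
    exact hdis e he f hf c hc x hx hcx
  -- a transversal of the left cosets
  let W : Set G := {x | x = 1 ∨ x ∈ U}
  have hWW : ∀ c ∈ C, ∀ x ∈ W, c * x ∈ W → c = 1 := by
    rintro c hc x (rfl | hx) (h | h)
    · simpa using h
    · exact absurd h (by simpa using hUC c hc)
    · exact absurd hx (hUC _ (by rw [eq_inv_of_mul_eq_one_right h]; exact C.inv_mem hc))
    · exact hUU c hc x hx h
  have hWcov : ∀ x, ∃ c ∈ C, c * x ∈ W := by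
    intro x
    by_cases hx : x ∈ C
    · exact ⟨x⁻¹, C.inv_mem hx, Or.inl (by simp)⟩
    · obtain ⟨c, hc, h⟩ := hcov x hx
      exact ⟨c, hc, Or.inr h⟩
  have hback : ∀ h, (∀ m ∈ W, m * h ∈ W) → ∀ m, m ∈ W ↔ m * h ∈ W := by
    intro h hh m
    refine ⟨hh m, fun hm => ?_⟩
    obtain ⟨c, hc, hcm⟩ := hWcov m
    have := hh _ hcm
    rw [mul_assoc] at this
    have := hWW c hc _ hm this
    simpa [this] using hcm
  let R : Subgroup G :=
    { carrier := {h | ∀ m, m ∈ W ↔ m * h ∈ W}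
      one_mem' := by simp
      mul_mem' := by
        intro a b ha hb m
        rw [ha m, hb, mul_assoc]
      inv_mem' := by
        intro a ha m
        rw [ha (m * a⁻¹), inv_mul_cancel_right] }
  have hRU : ∀ h ∈ R, h ≠ 1 → h ∈ U := by
    intro h hh h1
    have := (hh 1).1 (Or.inl rfl)
    rw [one_mul] at this
    exact this.resolve_left h1
  have hping : ∀ h ∈ R, h ≠ 1 → ∀ x ∉ U, h * x ∈ U := by
    intro h hh h1 x hx
    obtain ⟨e, he, hhe⟩ := hRU h hh h1
    obtain ⟨f, hf, hhf⟩ := hRU _ (R.inv_mem hh) (by simpa using h1)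
    have hxf : x ∉ f := fun h => hx ⟨f, hf, h⟩
    have h1f : 1 ∈ h • f := by rw [hsm, mul_one]; exact hhf
    have hfE := hL h f hf.1.1
    refine ⟨e, he, ?_⟩
    have hsub : (h • f)ᶜ ⊆ e := by
      rcases hn e he.1.1 _ hfE with h2 | h2 | h2 | h2
      · exact (he.1.2.2.2 _ (hc _ hfE) (by simpa using h1f) h2).symm.subset
      · have := h2 hhe
        rw [hsm, inv_mul_cancel] at this
        exact absurd this hf.1.2.2.1
      · exact absurd (h2 h1f) he.1.2.2.1
      · exact Set.compl_subset_comm.1 h2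
    apply hsub
    rw [Set.mem_compl_iff, hsm, inv_mul_cancel_left]
    exact hxf
  refine ⟨R, injective_coprodLift_of_pingPong C R U hUC
    (fun c hc h1 x hx h => h1 (hUU c hc x hx h)) hping, ?_⟩
  rw [Monoid.Coprod.range_lift, Subgroup.range_subtype, Subgroup.range_subtype, eq_top_iff]
  -- generation
  let S : G → G → Set (Set G) := fun x y => {e ∈ E | x ∉ e ∧ y ∈ e}
  have hSt : ∀ k x y, (S (k * x) (k * y)) = (fun e => k • e) '' S x y := by
    intro k x y
    ext e
    constructor
    · rintro ⟨he, h1, h2⟩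
      refine ⟨k⁻¹ • e, ⟨hL _ _ he, ?_, ?_⟩, smul_inv_smul k e⟩
      · rw [hsm]; simpa using h1
      · rw [hsm]; simpa using h2
    · rintro ⟨e, ⟨he, h1, h2⟩, rfl⟩
      refine ⟨hL _ _ he, ?_, ?_⟩
      · rw [hsm]; simpa using h1
      · rw [hsm]; simpa using h2
  have hScard : ∀ k x y, (S (k * x) (k * y)).ncard = (S x y).ncard := by
    intro k x y
    rw [hSt, Set.ncard_image_of_injective _ (MulAction.injective k)]
  have hSfin : ∀ x y, (S x y).Finite := by
    intro x y
    have := (hfin (x⁻¹ * y)).image (fun e => x • e)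
    have h2 := hSt x 1 (x⁻¹ * y)
    rw [mul_one, mul_inv_cancel_left] at h2
    rw [h2]; exact this
  have main : ∀ n : ℕ, ∀ g, (S 1 g).ncard = n → g ∈ C ⊔ R := by
    intro n
    induction n using Nat.strong_induction_on with
    | _ n ih =>
    have hU : ∀ g ∈ U, (S 1 g).ncard = n → g ∈ C ⊔ R := by
      intro g hg hgn
      by_cases hsp : ∃ m ∈ U, ∃ c ∈ C, c ≠ 1 ∧ c * (m * g) ∈ U
      · obtain ⟨m, ⟨e, he, hme⟩, c, hcC, hc1, ⟨f, hf, hcf⟩⟩ := hsp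
        have hf' := hCA _ (C.inv_mem hcC) f hf.1
        have hmgf : m * g ∈ c⁻¹ • f := by rw [hsm, inv_inv]; exact hcf
        have hmf : m ∉ c⁻¹ • f := by
          intro h
          rw [hsm, inv_inv] at h
          exact hc1 (hdis e he f hf c hcC m hme h)
        have hmge : m * g ∉ e := fun h => hc1 (hdis e he f hf c hcC _ h hcf)
        have hsub1 : S 1 (m * g) ⊆ S m (m * g) := by
          rintro e' ⟨he', h1, h2⟩
          refine ⟨he', fun h => ?_, h2⟩
          obtain ⟨f2, hf2, hef2⟩ := hmax e' he' h1 _ h2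
          rw [hdisj f2 hf2 _ hf' _ (hef2 h2) hmgf] at hef2
          exact hmf (hef2 h)
        have hsub2 : S m 1 ⊆ S m (m * g) := by
          rintro e' ⟨he', h1, h2⟩
          refine ⟨he', h1, ?_⟩
          by_contra h
          obtain ⟨f2, hf2, hef2⟩ := hmax e'ᶜ (hc _ he') (by simpa using h2) _ h1
          rw [hdisj f2 hf2 _ he.1 _ (hef2 h1) hme] at hef2
          exact hmge (hef2 h)
        have hcard := hScard m 1 g
        rw [mul_one] at hcard
        have hlt1 : (S 1 (m * g)).ncard < n := by
          rw [← hgn, ← hcard]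
          refine Set.ncard_lt_ncard (hsub1.ssubset_of_mem_notMem
            (a := eᶜ) ⟨hc _ he.1.1, by simpa using hme, by simpa using hmge⟩ ?_) (hSfin _ _)
          rintro ⟨_, h, _⟩
          exact h he.1.2.2.1
        have hlt2 : (S 1 m⁻¹).ncard < n := by
          have h3 := hScard m 1 m⁻¹
          rw [mul_one, mul_inv_cancel] at h3
          rw [← hgn, ← hcard, ← h3]
          refine Set.ncard_lt_ncard (hsub2.ssubset_of_mem_notMem
            (a := c⁻¹ • f) ⟨hf'.1, hmf, hmgf⟩ ?_) (hSfin _ _)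
          rintro ⟨_, _, h⟩
          exact hf'.2.2.1 h
        have := mul_mem (ih _ hlt2 _ rfl) (ih _ hlt1 _ rfl)
        simpa using this
      · push Not at hsp
        have hgC : g⁻¹ ∉ C := fun h => hUC g (by simpa using C.inv_mem h) hg
        obtain ⟨c, hcC, hcg⟩ := hcov _ hgC
        have hmem : g * c⁻¹ ∈ R := by
          apply hback
          rintro m (rfl | hm)
          · rw [one_mul]; exact Or.inr ((hUr _ (C.inv_mem hcC) g).2 hg)
          · rw [← mul_assoc]
            by_cases hmg : m * g ∈ C
            · left
              have h1 : (c * (m * g)⁻¹) * m ∈ U := by simpa [mul_assoc] using hcg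
              have h2 := hUU _ (C.mul_mem hcC (C.inv_mem hmg)) m hm h1
              rw [← mul_inv_eq_one.1 h2, mul_inv_cancel]
            · right
              obtain ⟨d, hd, hdm⟩ := hcov _ hmg
              have hd1 : d = 1 := by
                by_contra hd1
                exact hsp m hm d hd hd1 hdm
              rw [hd1, one_mul] at hdm
              exact (hUr _ (C.inv_mem hcC) _).2 hdm
        have h1 := mul_mem ((le_sup_right : R ≤ C ⊔ R) hmem) ((le_sup_left : C ≤ C ⊔ R) hcC)
        simpa using h1
    intro g hgn
    by_cases hg : g ∈ C
    · exact (le_sup_left : C ≤ C ⊔ R) hg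
    · obtain ⟨c, hcC, hcg⟩ := hcov g hg
      have h1 : S 1 (c * g) = S (c * 1) (c * g) := by
        ext e
        refine and_congr_right fun he => and_congr_left fun _ => not_congr ?_
        rw [mul_one]
        exact hcC e he
      have h2 := hU _ hcg (by rw [h1, hScard, hgn])
      have h3 := mul_mem ((le_sup_left : C ≤ C ⊔ R) (C.inv_mem hcC)) h2
      simpa using h3
  intro g _
  exact main _ g rfl

end NestedFamily

section Cuts

variable {V : Type*}

/-- The directed edges of the relation `H` which leave the set `B`. -/
def cutBd (H : V → V → Prop) (B : Set V) : Set (V × V) := {p | H p.1 p.2 ∧ p.1 ∈ B ∧ p.2 ∉ B}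

/-- The graph `H` is connected: no proper nonempty set has empty boundary. -/
def CutConnected (H : V → V → Prop) : Prop := ∀ P, cutBd H P = ∅ → P = ∅ ∨ P = Set.univ

/-- The set `B` spans a connected subgraph of `H`. -/
def CutConnectedOn (H : V → V → Prop) (B : Set V) : Prop :=
  ∀ P ⊆ B, P.Nonempty → (∀ x ∈ P, ∀ y ∈ B, H x y → y ∈ P) → P = B

/-- All four corners of the sets `A` and `B` are nonempty. -/
def Crossing (A B : Set V) : Prop :=
  (A ∩ B).Nonempty ∧ (A ∩ Bᶜ).Nonempty ∧ (Aᶜ ∩ B).Nonempty ∧ (Aᶜ ∩ Bᶜ).Nonempty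

theorem Crossing.symm {A B : Set V} (h : Crossing A B) : Crossing B A := by
  unfold Crossing at *
  rw [Set.inter_comm B A, Set.inter_comm B, Set.inter_comm Bᶜ A, Set.inter_comm Bᶜ]
  tauto

theorem Crossing.compl_right {A B : Set V} (h : Crossing A B) : Crossing A Bᶜ := by
  unfold Crossing at *
  rw [compl_compl]
  tauto

theorem crossing_compl_right {A B : Set V} : Crossing A Bᶜ ↔ Crossing A B :=
  ⟨fun h => by simpa using h.compl_right, Crossing.compl_right⟩

theorem crossing_comm {A B : Set V} : Crossing A B ↔ Crossing B A := ⟨.symm, .symm⟩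

theorem crossing_compl_left {A B : Set V} : Crossing Aᶜ B ↔ Crossing A B := by
  rw [crossing_comm, crossing_compl_right, crossing_comm]

theorem cutBd_compl {H : V → V → Prop} (hs : ∀ x y, H x y → H y x) (B : Set V) :
    cutBd H Bᶜ = Prod.swap '' cutBd H B := by
  ext ⟨x, y⟩
  simp only [cutBd, Set.mem_ofPred_eq, Set.mem_compl_iff, not_not, Set.mem_image, Prod.exists,
    Prod.swap_prod_mk, Prod.mk.injEq]
  constructor
  · rintro ⟨h, hx, hy⟩
    exact ⟨y, x, ⟨hs _ _ h, hy, hx⟩, rfl, rfl⟩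
  · rintro ⟨a, b, ⟨h, ha, hb⟩, rfl, rfl⟩
    exact ⟨hs _ _ h, hb, ha⟩

theorem finite_cutBd_compl {H : V → V → Prop} (hs : ∀ x y, H x y → H y x) {B : Set V}
    (hB : (cutBd H B).Finite) : (cutBd H Bᶜ).Finite := by
  rw [cutBd_compl hs]; exact hB.image _

theorem ncard_cutBd_compl {H : V → V → Prop} (hs : ∀ x y, H x y → H y x) (B : Set V) :
    (cutBd H Bᶜ).ncard = (cutBd H B).ncard := by
  rw [cutBd_compl hs, Set.ncard_image_of_injective _ Prod.swap_injective]

theorem cutBd_inter_subset (H : V → V → Prop) (A B : Set V) :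
    cutBd H (A ∩ B) ⊆ cutBd H A ∪ cutBd H B := by
  rintro ⟨x, y⟩ ⟨h, hx, hy⟩
  by_cases hyA : y ∈ A
  · exact Or.inr ⟨h, hx.2, fun hyB => hy ⟨hyA, hyB⟩⟩
  · exact Or.inl ⟨h, hx.1, hyA⟩

theorem finite_cutBd_inter {H : V → V → Prop} {A B : Set V}
    (hA : (cutBd H A).Finite) (hB : (cutBd H B).Finite) : (cutBd H (A ∩ B)).Finite :=
  (hA.union hB).subset (cutBd_inter_subset H A B)

theorem ncard_corners_le {H : V → V → Prop} (hs : ∀ x y, H x y → H y x) {A B : Set V}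
    (hA : (cutBd H A).Finite) (hB : (cutBd H B).Finite) :
    (cutBd H (A ∩ B)).ncard + (cutBd H (Aᶜ ∩ Bᶜ)).ncard ≤
      (cutBd H A).ncard + (cutBd H B).ncard := by
  rw [← Set.compl_union, ncard_cutBd_compl hs]
  have h1 : cutBd H (A ∩ B) ∪ cutBd H (A ∪ B) ⊆ cutBd H A ∪ cutBd H B := by
    rintro ⟨x, y⟩ (h | ⟨h, hx, hy⟩)
    · exact cutBd_inter_subset H A B h
    · simp only [Set.mem_union, not_or] at hy
      rcases hx with hx | hx
      · exact Or.inl ⟨h, hx, hy.1⟩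
      · exact Or.inr ⟨h, hx, hy.2⟩
  have h2 : cutBd H (A ∩ B) ∩ cutBd H (A ∪ B) ⊆ cutBd H A ∩ cutBd H B := by
    rintro ⟨x, y⟩ ⟨⟨h, hx, -⟩, ⟨-, -, hy⟩⟩
    simp only [Set.mem_union, not_or] at hy
    exact ⟨⟨h, hx.1, hy.1⟩, ⟨h, hx.2, hy.2⟩⟩
  have hf := hA.union hB
  have hf1 := (hf.subset h1).subset Set.subset_union_left
  have hf2 := (hf.subset h1).subset Set.subset_union_right
  have e1 := Set.ncard_union_add_ncard_inter _ _ hf1 hf2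
  have e2 := Set.ncard_union_add_ncard_inter _ _ hA hB
  have i1 := Set.ncard_le_ncard h1 hf
  have i2 := Set.ncard_le_ncard h2 (hA.subset Set.inter_subset_left)
  omega

/-- A finite set of edges of a connected graph meets the boundary of every set
which separates two given vertices. -/
theorem exists_finite_edges_of_cutConnected {H : V → V → Prop} (hc : CutConnected H) (u v : V) :
    ∃ T : Set (V × V), T.Finite ∧ ∀ B, u ∈ B → v ∉ B → ∃ p ∈ T, p ∈ cutBd H B := by
  let P : Set V := {w | ∃ T : Set (V × V), T.Finite ∧
    ∀ B, u ∈ B → w ∉ B → ∃ p ∈ T, p ∈ cutBd H B}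
  have hu : u ∈ P := ⟨∅, Set.finite_empty, fun B h1 h2 => absurd h1 h2⟩
  have hP : cutBd H P = ∅ := by
    ext ⟨x, y⟩
    simp only [Set.mem_empty_iff_false, iff_false]
    rintro ⟨h, ⟨T, hT, hTB⟩, hy⟩
    refine hy ⟨insert (x, y) T, hT.insert _, fun B huB hyB => ?_⟩
    by_cases hx : x ∈ B
    · exact ⟨(x, y), Set.mem_insert _ _, h, hx, hyB⟩
    · obtain ⟨p, hp, hpB⟩ := hTB B huB hx
      exact ⟨p, Set.mem_insert_of_mem _ hp, hpB⟩
  rcases hc P hP with h | h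
  · rw [h] at hu; exact absurd hu (Set.notMem_empty _)
  · have : v ∈ P := h ▸ Set.mem_univ v
    exact this

/-- In a connected graph there are only finitely many connected and co-connected sets with
boundary of bounded size separating two given vertices. -/
theorem finite_connected_cuts (k : ℕ) : ∀ {H : V → V → Prop}, (∀ x y, H x y → H y x) →
    CutConnected H → ∀ u v, {B | CutConnectedOn H B ∧ CutConnectedOn H Bᶜ ∧ (cutBd H B).Finite ∧
      (cutBd H B).ncard ≤ k ∧ u ∈ B ∧ v ∉ B}.Finite := by
  induction k with
  | zero =>
    intro H hs hc u v
    convert Set.finite_empty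
    ext B
    simp only [Set.mem_ofPred_eq, Set.mem_empty_iff_false, iff_false]
    rintro ⟨-, -, hf, hk, hu, hv⟩
    obtain ⟨T, -, hT⟩ := exists_finite_edges_of_cutConnected hc u v
    obtain ⟨p, -, hp⟩ := hT B hu hv
    rw [Nat.le_zero, Set.ncard_eq_zero hf] at hk
    rw [hk] at hp; exact hp
  | succ k ih =>
    intro H hs hc u v
    obtain ⟨T, hTf, hT⟩ := exists_finite_edges_of_cutConnected hc u v
    suffices hxy : ∀ x y, {B | CutConnectedOn H B ∧ CutConnectedOn H Bᶜ ∧ (cutBd H B).Finite ∧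
        (cutBd H B).ncard ≤ k + 1 ∧ (x, y) ∈ cutBd H B}.Finite by
      refine (hTf.biUnion fun p _ => hxy p.1 p.2).subset ?_
      rintro B ⟨h1, h2, h3, h4, hu, hv⟩
      obtain ⟨p, hp, hpB⟩ := hT B hu hv
      exact Set.mem_biUnion hp ⟨h1, h2, h3, h4, hpB⟩
    intro x y
    let H' : V → V → Prop := fun a b => H a b ∧ ¬ (a = x ∧ b = y) ∧ ¬ (a = y ∧ b = x)
    have hs' : ∀ a b, H' a b → H' b a := fun a b ⟨h, h1, h2⟩ =>
      ⟨hs _ _ h, fun h3 => h2 ⟨h3.2, h3.1⟩, fun h3 => h1 ⟨h3.2, h3.1⟩⟩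
    have hconn : ∀ B, x ∈ B → y ∉ B → CutConnectedOn H B → CutConnectedOn H' B := by
      intro B hx hy hB P hPB hPn hP
      refine hB P hPB hPn fun a ha b hb hab => hP a ha b hb ⟨hab, ?_, ?_⟩
      · rintro ⟨-, rfl⟩; exact hy hb
      · rintro ⟨rfl, -⟩; exact hy (hPB ha)
    have hconn' : ∀ B, x ∉ B → y ∈ B → CutConnectedOn H B → CutConnectedOn H' B := by
      intro B hx hy hB P hPB hPn hP
      refine hB P hPB hPn fun a ha b hb hab => hP a ha b hb ⟨hab, ?_, ?_⟩
      · rintro ⟨rfl, -⟩; exact hx (hPB ha)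
      · rintro ⟨-, rfl⟩; exact hx hb
    by_cases hc' : CutConnected H'
    · refine (ih hs' hc' x y).subset ?_
      rintro B ⟨h1, h2, h3, h4, hB⟩
      have hsub : cutBd H' B ⊆ cutBd H B := fun p hp => ⟨hp.1.1, hp.2⟩
      refine ⟨hconn B hB.2.1 hB.2.2 h1, hconn' Bᶜ (by simpa using hB.2.1) hB.2.2 h2,
        h3.subset hsub, ?_, hB.2.1, hB.2.2⟩
      have := Set.ncard_lt_ncard (hsub.ssubset_of_mem_notMem hB
        (fun h => h.1.2.1 ⟨rfl, rfl⟩)) h3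
      omega
    · unfold CutConnected at hc'
      push Not at hc'
      obtain ⟨P, hP, hP1, hP2⟩ := hc'
      wlog hxP : x ∈ P generalizing P
      · refine this Pᶜ ?_ ?_ ?_ hxP
        · rw [cutBd_compl hs', hP, Set.image_empty]
        · exact Set.nonempty_compl.2 hP2
        · rw [Ne, Set.compl_univ_iff]; exact hP1.ne_empty
      have hmem : ∀ a b, H' a b → a ∈ P → b ∈ P := by
        intro a b hab ha
        by_contra hb
        have : (a, b) ∈ cutBd H' P := ⟨hab, ha, hb⟩
        rw [hP] at this; exact this
      have hyP : y ∉ P := by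
        intro hyP
        refine (hc P ?_).elim hP1.ne_empty hP2
        ext ⟨a, b⟩
        simp only [Set.mem_empty_iff_false, iff_false]
        rintro ⟨hab, ha, hb⟩
        refine hb (hmem a b ⟨hab, ?_, ?_⟩ ha)
        · rintro ⟨-, rfl⟩; exact hb hyP
        · rintro ⟨-, rfl⟩; exact hb hxP
      refine (Set.finite_singleton P).subset ?_
      rintro B ⟨h1, h2, h3, h4, hB⟩
      rw [Set.mem_singleton_iff]
      have e1 : B ∩ P = B := hconn B hB.2.1 hB.2.2 h1 _ Set.inter_subset_left ⟨x, hB.2.1, hxP⟩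
        fun a ha b hb hab => ⟨hb, hmem a b hab ha.2⟩
      have e2 : Bᶜ ∩ Pᶜ = Bᶜ := hconn' Bᶜ (by simpa using hB.2.1) hB.2.2 h2 _
        Set.inter_subset_left ⟨y, hB.2.2, hyP⟩
        fun a ha b hb hab => ⟨hb, fun hbP => ha.2 (hmem b a (hs' _ _ hab) hbP)⟩
      exact subset_antisymm (Set.inter_eq_left.1 e1)
        (Set.compl_subset_compl.1 (Set.inter_eq_left.1 e2))

end Cuts

section CutSystem

variable {V : Type*}

/-- The set `B` separates the two filters of the pair `p`. -/
def Separates (p : Filter V × Filter V) (B : Set V) : Prop :=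
  (B ∈ p.1 ∧ Bᶜ ∈ p.2) ∨ (Bᶜ ∈ p.1 ∧ B ∈ p.2)

theorem Separates.compl {p : Filter V × Filter V} {B : Set V} (h : Separates p B) :
    Separates p Bᶜ := by
  unfold Separates at *
  rw [compl_compl]
  tauto

/-- A connected graph with pairs of ends which are separated by cuts of bounded size. -/
structure CutSystem (V : Type*) where
  H : V → V → Prop
  symm : ∀ x y, H x y → H y x
  conn : CutConnected H
  pairs : Set (Filter V × Filter V)
  neBot_fst : ∀ p ∈ pairs, p.1.NeBot
  neBot_snd : ∀ p ∈ pairs, p.2.NeBot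
  decides_fst : ∀ p ∈ pairs, ∀ B, (cutBd H B).Finite → B ∈ p.1 ∨ Bᶜ ∈ p.1
  decides_snd : ∀ p ∈ pairs, ∀ B, (cutBd H B).Finite → B ∈ p.2 ∨ Bᶜ ∈ p.2
  bound : ℕ
  exists_cut : ∀ p ∈ pairs, ∃ B, (cutBd H B).Finite ∧ (cutBd H B).ncard ≤ bound ∧ Separates p B

namespace CutSystem

variable (S : CutSystem V)

/-- The cuts of minimal size separating `p`. -/
def minCuts (p : Filter V × Filter V) : Set (Set V) :=
  {B | (cutBd S.H B).Finite ∧ Separates p B ∧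
    ∀ B', (cutBd S.H B').Finite → Separates p B' → (cutBd S.H B).ncard ≤ (cutBd S.H B').ncard}

/-- The cuts of minimal size separating some pair. -/
def allMinCuts : Set (Set V) := {B | ∃ p ∈ S.pairs, B ∈ S.minCuts p}

/-- The number of minimal cuts crossing `A`. -/
noncomputable def crossings (A : Set V) : ℕ := {B | B ∈ S.allMinCuts ∧ Crossing A B}.ncard

/-- The minimal cuts separating `p` which cross as few minimal cuts as possible. -/
def optCuts (p : Filter V × Filter V) : Set (Set V) :=
  {A | A ∈ S.minCuts p ∧ ∀ B ∈ S.minCuts p, S.crossings A ≤ S.crossings B}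

/-- The optimal cuts of all pairs. -/
def allOptCuts : Set (Set V) := {B | ∃ p ∈ S.pairs, B ∈ S.optCuts p}

variable {S}

theorem compl_mem_minCuts {p : Filter V × Filter V} {B : Set V} (h : B ∈ S.minCuts p) :
    Bᶜ ∈ S.minCuts p := by
  refine ⟨finite_cutBd_compl S.symm h.1, h.2.1.compl, ?_⟩
  rw [ncard_cutBd_compl S.symm]
  exact h.2.2

theorem crossings_compl (A : Set V) : S.crossings Aᶜ = S.crossings A := by
  unfold crossings
  simp only [crossing_compl_left]

theorem compl_mem_optCuts {p : Filter V × Filter V} {B : Set V} (h : B ∈ S.optCuts p) :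
    Bᶜ ∈ S.optCuts p := by
  refine ⟨compl_mem_minCuts h.1, ?_⟩
  rw [crossings_compl]
  exact h.2

theorem cutConnectedOn_of_mem_minCuts {p : Filter V × Filter V} (hp : p ∈ S.pairs) {B : Set V}
    (hB : B ∈ S.minCuts p) : CutConnectedOn S.H B := by
  have hn1 := S.neBot_fst p hp
  have hn2 := S.neBot_snd p hp
  have key : ∀ Q ⊆ B, (∀ x ∈ Q, ∀ y ∈ B, S.H x y → y ∈ Q) → Separates p Q → Q = B := by
    intro Q hQB hQ hsep
    have hsub : cutBd S.H Q ⊆ cutBd S.H B := by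
      rintro ⟨x, y⟩ ⟨h, hx, hy⟩
      exact ⟨h, hQB hx, fun hyB => hy (hQ x hx y hyB h)⟩
    have heq : cutBd S.H Q = cutBd S.H B :=
      Set.eq_of_subset_of_ncard_le hsub (hB.2.2 Q (hB.1.subset hsub) hsep) hB.1
    have hempty : cutBd S.H (B \ Q) = ∅ := by
      ext ⟨x, y⟩
      simp only [Set.mem_empty_iff_false, iff_false]
      rintro ⟨h, hx, hy⟩
      by_cases hyB : y ∈ B
      · have hyQ : y ∈ Q := by
          by_contra hyQ; exact hy ⟨hyB, hyQ⟩
        exact hx.2 (hQ y hyQ x hx.1 (S.symm _ _ h))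
      · have : (x, y) ∈ cutBd S.H Q := by rw [heq]; exact ⟨h, hx.1, hyB⟩
        exact hx.2 this.2.1
    rcases S.conn _ hempty with h | h
    · exact subset_antisymm hQB (Set.sdiff_eq_empty.1 h)
    · exfalso
      have hQe : Q = ∅ := by
        ext z
        have : z ∈ B \ Q := h ▸ Set.mem_univ z
        simp [this.2]
      subst hQe
      rcases hsep with h | h
      · exact hn1.ne (Filter.empty_mem_iff_bot.1 h.1)
      · exact hn2.ne (Filter.empty_mem_iff_bot.1 h.2)
  intro P hPB hPn hP
  have hsubP : cutBd S.H P ⊆ cutBd S.H B := by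
    rintro ⟨x, y⟩ ⟨h, hx, hy⟩
    exact ⟨h, hPB hx, fun hyB => hy (hP x hx y hyB h)⟩
  have hfin := hB.1.subset hsubP
  have hQ : Separates p (B \ P) → P = B := by
    intro hsep
    have := key (B \ P) Set.sdiff_subset (fun x hx y hy h => ⟨hy, fun hyP => hx.2
      (hP y hyP x hx.1 (S.symm _ _ h))⟩) hsep
    obtain ⟨z, hz⟩ := hPn
    have hz' : z ∈ B \ P := by rw [this]; exact hPB hz
    exact absurd hz hz'.2
  rcases hB.2.1 with ⟨h1, h2⟩ | ⟨h1, h2⟩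
  · rcases S.decides_fst p hp P hfin with h | h
    · exact key P hPB hP (Or.inl ⟨h, mem_of_superset h2 (Set.compl_subset_compl.2 hPB)⟩)
    · exact hQ (Or.inl ⟨inter_mem h1 h,
        mem_of_superset h2 (Set.compl_subset_compl.2 Set.sdiff_subset)⟩)
  · rcases S.decides_snd p hp P hfin with h | h
    · exact key P hPB hP (Or.inr ⟨mem_of_superset h1 (Set.compl_subset_compl.2 hPB), h⟩)
    · exact hQ (Or.inr ⟨mem_of_superset h1 (Set.compl_subset_compl.2 Set.sdiff_subset),
        inter_mem h2 h⟩)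

theorem finite_minCuts_separating (S : CutSystem V) (u v : V) :
    {B | B ∈ S.allMinCuts ∧ u ∈ B ∧ v ∉ B}.Finite := by
  refine (finite_connected_cuts S.bound S.symm S.conn u v).subset ?_
  rintro B ⟨⟨p, hp, hB⟩, hu, hv⟩
  refine ⟨cutConnectedOn_of_mem_minCuts hp hB,
    cutConnectedOn_of_mem_minCuts hp (compl_mem_minCuts hB), hB.1, ?_, hu, hv⟩
  obtain ⟨B', h1, h2, h3⟩ := S.exists_cut p hp
  exact (hB.2.2 B' h1 h3).trans h2

theorem finite_crossing {A : Set V} (hA : A ∈ S.allMinCuts) :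
    {B | B ∈ S.allMinCuts ∧ Crossing A B}.Finite := by
  obtain ⟨p, hp, hA⟩ := hA
  let T : Set V := Prod.fst '' cutBd S.H A
  have hT : T.Finite := hA.1.image _
  refine (hT.biUnion fun u _ => hT.biUnion fun v _ => finite_minCuts_separating S u v).subset ?_
  rintro B ⟨⟨q, hq, hB⟩, hAB⟩
  have key : ∀ B, CutConnectedOn S.H B → Crossing A B → ∃ x ∈ T, x ∈ B := by
    intro B hB hAB
    by_contra! hcon
    have := hB (A ∩ B) Set.inter_subset_right hAB.1 (fun x hx y hy h => ⟨?_, hy⟩)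
    · obtain ⟨z, hz1, hz2⟩ := hAB.2.2.1
      rw [← this] at hz2
      exact hz1 hz2.1
    · by_contra hyA
      exact hcon x ⟨(x, y), ⟨h, hx.1, hyA⟩, rfl⟩ hx.2
  obtain ⟨u, hu, huB⟩ := key B (cutConnectedOn_of_mem_minCuts hq hB) hAB
  obtain ⟨v, hv, hvB⟩ := key Bᶜ (cutConnectedOn_of_mem_minCuts hq (compl_mem_minCuts hB))
    hAB.compl_right
  exact Set.mem_biUnion hu (Set.mem_biUnion hv ⟨⟨q, hq, hB⟩, huB, hvB⟩)

theorem crossing_of_crossing_inter {A B C : Set V} (hY : (Aᶜ ∩ Bᶜ).Nonempty)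
    (h : Crossing (A ∩ B) C) : Crossing A C ∨ Crossing B C := by
  unfold Crossing at *
  obtain ⟨⟨a, ⟨ha1, ha2⟩, ha3⟩, ⟨b, ⟨hb1, hb2⟩, hb3⟩, ⟨c, hc1, hc2⟩, ⟨d, hd1, hd2⟩⟩ := h
  obtain ⟨y, hy1, hy2⟩ := hY
  have e1 : (A ∩ C).Nonempty := ⟨a, ha1, ha3⟩
  have e2 : (B ∩ C).Nonempty := ⟨a, ha2, ha3⟩
  have e3 : (A ∩ Cᶜ).Nonempty := ⟨b, hb1, hb3⟩
  have e4 : (B ∩ Cᶜ).Nonempty := ⟨b, hb2, hb3⟩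
  have c' : (Aᶜ ∩ C).Nonempty ∨ (Bᶜ ∩ C).Nonempty := by
    by_cases hcA : c ∈ A
    · exact Or.inr ⟨c, fun hcB => hc1 ⟨hcA, hcB⟩, hc2⟩
    · exact Or.inl ⟨c, hcA, hc2⟩
  have d' : (Aᶜ ∩ Cᶜ).Nonempty ∨ (Bᶜ ∩ Cᶜ).Nonempty := by
    by_cases hdA : d ∈ A
    · exact Or.inr ⟨d, fun hdB => hd1 ⟨hdA, hdB⟩, hd2⟩
    · exact Or.inl ⟨d, hdA, hd2⟩
  have y' : ((Aᶜ ∩ C).Nonempty ∧ (Bᶜ ∩ C).Nonempty) ∨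
      ((Aᶜ ∩ Cᶜ).Nonempty ∧ (Bᶜ ∩ Cᶜ).Nonempty) := by
    by_cases hyC : y ∈ C
    · exact Or.inl ⟨⟨y, hy1, hyC⟩, ⟨y, hy2, hyC⟩⟩
    · exact Or.inr ⟨⟨y, hy1, hyC⟩, ⟨y, hy2, hyC⟩⟩
  tauto

theorem crossings_corners_lt {A B : Set V} (hA : A ∈ S.allMinCuts) (hB : B ∈ S.allMinCuts)
    (h : Crossing A B) :
    S.crossings (A ∩ B) + S.crossings (Aᶜ ∩ Bᶜ) < S.crossings A + S.crossings B := by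
  unfold crossings
  let X : Set V → Set (Set V) := fun A => {B | B ∈ S.allMinCuts ∧ Crossing A B}
  change (X (A ∩ B)).ncard + (X (Aᶜ ∩ Bᶜ)).ncard < (X A).ncard + (X B).ncard
  have hfA : (X A).Finite := finite_crossing hA
  have hfB : (X B).Finite := finite_crossing hB
  have h1 : X (A ∩ B) ∪ X (Aᶜ ∩ Bᶜ) ⊆ X A ∪ X B := by
    rintro C (⟨hC, hc⟩ | ⟨hC, hc⟩)
    · exact (crossing_of_crossing_inter h.2.2.2 hc).imp (fun h => ⟨hC, h⟩) fun h => ⟨hC, h⟩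
    · have := crossing_of_crossing_inter (by simpa using h.1) hc
      rw [crossing_compl_left, crossing_compl_left] at this
      exact this.imp (fun h => ⟨hC, h⟩) fun h => ⟨hC, h⟩
  have h2 : X (A ∩ B) ∩ X (Aᶜ ∩ Bᶜ) ⊆ X A ∩ X B := by
    rintro C ⟨⟨hC, ⟨a, ha⟩, ⟨b, hb⟩, -⟩, ⟨-, ⟨c, hc⟩, ⟨d, hd⟩, -⟩⟩
    exact ⟨⟨hC, ⟨a, ha.1.1, ha.2⟩, ⟨b, hb.1.1, hb.2⟩, ⟨c, hc.1.1, hc.2⟩, ⟨d, hd.1.1, hd.2⟩⟩,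
      ⟨hC, ⟨a, ha.1.2, ha.2⟩, ⟨b, hb.1.2, hb.2⟩, ⟨c, hc.1.2, hc.2⟩, ⟨d, hd.1.2, hd.2⟩⟩⟩
  have h3 : A ∉ X (A ∩ B) ∪ X (Aᶜ ∩ Bᶜ) := by
    rintro (⟨-, -, ⟨b, hb⟩, -⟩ | ⟨-, ⟨b, hb⟩, -⟩)
    · exact hb.2 hb.1.1
    · exact hb.1.1 hb.2
  have h4 : A ∈ X A ∪ X B := Or.inr ⟨hA, h.symm⟩
  have hf := hfA.union hfB
  have hf1 := (hf.subset h1).subset Set.subset_union_left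
  have hf2 := (hf.subset h1).subset Set.subset_union_right
  have e1 := Set.ncard_union_add_ncard_inter _ _ hf1 hf2
  have e2 := Set.ncard_union_add_ncard_inter _ _ hfA hfB
  have i1 := Set.ncard_lt_ncard (h1.ssubset_of_mem_notMem h4 h3) hf
  have i2 := Set.ncard_le_ncard h2 (hfA.subset Set.inter_subset_left)
  omega

theorem mem_minCuts_of_ncard_le {p : Filter V × Filter V} {A X : Set V} (hA : A ∈ S.minCuts p)
    (hX : (cutBd S.H X).Finite) (hs : Separates p X)
    (h : (cutBd S.H X).ncard ≤ (cutBd S.H A).ncard) : X ∈ S.minCuts p :=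
  ⟨hX, hs, fun B hB hB' => h.trans (hA.2.2 B hB hB')⟩

theorem not_separates_opposite {p q : Filter V × Filter V} (hp : p ∈ S.pairs) (hq : q ∈ S.pairs)
    {A B : Set V} (hA : A ∈ S.optCuts p) (hB : B ∈ S.optCuts q) (h : Crossing A B)
    (h1 : Separates p (A ∩ B)) (h2 : Separates q (Aᶜ ∩ Bᶜ)) : False := by
  have hf1 := finite_cutBd_inter hA.1.1 hB.1.1
  have hf2 := finite_cutBd_inter (finite_cutBd_compl S.symm hA.1.1)
    (finite_cutBd_compl S.symm hB.1.1)
  have hc := ncard_corners_le S.symm hA.1.1 hB.1.1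
  have m1 := hA.1.2.2 _ hf1 h1
  have m2 := hB.1.2.2 _ hf2 h2
  have x1 := hA.2 _ (mem_minCuts_of_ncard_le hA.1 hf1 h1 (by omega))
  have x2 := hB.2 _ (mem_minCuts_of_ncard_le hB.1 hf2 h2 (by omega))
  have := crossings_corners_lt ⟨p, hp, hA.1⟩ ⟨q, hq, hB.1⟩ h
  omega

theorem not_separates_all {p q : Filter V × Filter V} (hp : p ∈ S.pairs) (hq : q ∈ S.pairs)
    {A B : Set V} (hA : A ∈ S.optCuts p) (hB : B ∈ S.optCuts q) (h : Crossing A B)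
    (h1 : Separates p (A ∩ B)) (h2 : Separates p (Aᶜ ∩ Bᶜ))
    (h3 : Separates q (A ∩ Bᶜ)) (h4 : Separates q (Aᶜ ∩ B)) : False := by
  have hA' := finite_cutBd_compl S.symm hA.1.1
  have hB' := finite_cutBd_compl S.symm hB.1.1
  have hf1 := finite_cutBd_inter hA.1.1 hB.1.1
  have hf2 := finite_cutBd_inter hA' hB'
  have hf3 := finite_cutBd_inter hA.1.1 hB'
  have hf4 := finite_cutBd_inter hA' hB.1.1
  have hc := ncard_corners_le S.symm hA.1.1 hB.1.1
  have hc' := ncard_corners_le S.symm hA.1.1 hB'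
  have m1 := hA.1.2.2 _ hf1 h1
  have m2 := hA.1.2.2 _ hf2 h2
  have m3 := hB.1.2.2 _ hf3 h3
  have m4 := hB.1.2.2 _ hf4 h4
  have l := crossings_corners_lt ⟨p, hp, hA.1⟩ ⟨q, hq, hB.1⟩ h
  have l' := crossings_corners_lt ⟨p, hp, hA.1⟩ ⟨q, hq, compl_mem_minCuts hB.1⟩ h.compl_right
  rw [compl_compl] at hc' l'
  rw [ncard_cutBd_compl S.symm B] at hc'
  rw [crossings_compl B] at l'
  have x1 := hA.2 _ (mem_minCuts_of_ncard_le hA.1 hf1 h1 (by omega))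
  have x2 := hA.2 _ (mem_minCuts_of_ncard_le hA.1 hf2 h2 (by omega))
  have x3 := hB.2 _ (mem_minCuts_of_ncard_le hB.1 hf3 h3 (by omega))
  have x4 := hB.2 _ (mem_minCuts_of_ncard_le hB.1 hf4 h4 (by omega))
  omega

theorem not_crossing_of_mem_optCuts {p q : Filter V × Filter V} (hp : p ∈ S.pairs)
    (hq : q ∈ S.pairs) {A B : Set V} (hA : A ∈ S.optCuts p) (hB : B ∈ S.optCuts q) :
    ¬ Crossing A B := by
  intro h
  wlog hAp : A ∈ p.1 ∧ Aᶜ ∈ p.2 generalizing A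
  · refine this (compl_mem_optCuts hA) (crossing_compl_left.2 h) ?_
    rw [compl_compl]
    exact hA.1.2.1.resolve_left hAp
  wlog hBq : B ∈ q.1 ∧ Bᶜ ∈ q.2 generalizing B
  · refine this (compl_mem_optCuts hB) (crossing_compl_right.2 h) ?_
    rw [compl_compl]
    exact hB.1.2.1.resolve_left hBq
  have sub : ∀ {f : Filter V} {X Y : Set V}, Xᶜ ∈ f → (X ∩ Y)ᶜ ∈ f := fun hX =>
    mem_of_superset hX (Set.compl_subset_compl.2 Set.inter_subset_left)
  have sub' : ∀ {f : Filter V} {X Y : Set V}, Yᶜ ∈ f → (X ∩ Y)ᶜ ∈ f := fun hX =>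
    mem_of_superset hX (Set.compl_subset_compl.2 Set.inter_subset_right)
  have s1 : B ∈ p.1 → Separates p (A ∩ B) := fun h => Or.inl ⟨inter_mem hAp.1 h, sub hAp.2⟩
  have s2 : Bᶜ ∈ p.1 → Separates p (A ∩ Bᶜ) := fun h => Or.inl ⟨inter_mem hAp.1 h, sub hAp.2⟩
  have s3 : B ∈ p.2 → Separates p (Aᶜ ∩ B) := fun h =>
    Or.inr ⟨sub (by rw [compl_compl]; exact hAp.1), inter_mem hAp.2 h⟩
  have s4 : Bᶜ ∈ p.2 → Separates p (Aᶜ ∩ Bᶜ) := fun h =>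
    Or.inr ⟨sub (by rw [compl_compl]; exact hAp.1), inter_mem hAp.2 h⟩
  have t1 : A ∈ q.1 → Separates q (A ∩ B) := fun h => Or.inl ⟨inter_mem h hBq.1, sub' hBq.2⟩
  have t3 : Aᶜ ∈ q.1 → Separates q (Aᶜ ∩ B) := fun h => Or.inl ⟨inter_mem h hBq.1, sub' hBq.2⟩
  have t2 : A ∈ q.2 → Separates q (A ∩ Bᶜ) := fun h =>
    Or.inr ⟨sub' (by rw [compl_compl]; exact hBq.1), inter_mem h hBq.2⟩
  have t4 : Aᶜ ∈ q.2 → Separates q (Aᶜ ∩ Bᶜ) := fun h =>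
    Or.inr ⟨sub' (by rw [compl_compl]; exact hBq.1), inter_mem h hBq.2⟩
  have hA' := compl_mem_optCuts hA
  have hB' := compl_mem_optCuts hB
  have n14 := not_separates_opposite hp hq hA hB h
  have n23 := not_separates_opposite hp hq hA hB' h.compl_right
  have n32 := not_separates_opposite hp hq hA' hB (crossing_compl_left.2 h)
  have n41 := not_separates_opposite hp hq hA' hB' (crossing_compl_left.2 h.compl_right)
  have a1 := not_separates_all hp hq hA hB h
  have a2 := not_separates_all hp hq hA hB' h.compl_right
  simp only [compl_compl] at n14 n23 n32 n41 a1 a2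
  have d1 := S.decides_fst p hp B hB.1.1
  have d2 := S.decides_snd p hp B hB.1.1
  have d3 := S.decides_fst q hq A hA.1.1
  have d4 := S.decides_snd q hq A hA.1.1
  rcases d1 with d1 | d1 <;> rcases d2 with d2 | d2 <;> rcases d3 with d3 | d3 <;>
    rcases d4 with d4 | d4 <;>
    first
      | exact n14 (s1 d1) (t4 d4)
      | exact n41 (s4 d2) (t1 d3)
      | exact n23 (s2 d1) (t3 d3)
      | exact n32 (s3 d2) (t2 d4)
      | exact a1 (s1 d1) (s4 d2) (t2 d4) (t3 d3)
      | exact a2 (s2 d1) (s3 d2) (t1 d3) (t4 d4)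

theorem exists_forall_le {α : Type*} {s : Set α} (hs : s.Nonempty) (f : α → ℕ) :
    ∃ a ∈ s, ∀ b ∈ s, f a ≤ f b := by
  obtain ⟨a, ha, h⟩ := (measure f).wf.has_min s hs
  exact ⟨a, ha, fun b hb => not_lt.1 (h b hb)⟩

theorem exists_mem_optCuts {p : Filter V × Filter V} (hp : p ∈ S.pairs) :
    (S.optCuts p).Nonempty := by
  obtain ⟨B, h1, -, h2⟩ := S.exists_cut p hp
  obtain ⟨A, hA, hmin⟩ := exists_forall_le
    (s := {B | (cutBd S.H B).Finite ∧ Separates p B}) ⟨B, h1, h2⟩ fun B => (cutBd S.H B).ncard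
  obtain ⟨C, hC, hmin'⟩ := exists_forall_le (s := S.minCuts p)
    ⟨A, hA.1, hA.2, fun B h h' => hmin B ⟨h, h'⟩⟩ S.crossings
  exact ⟨C, hC, hmin'⟩

theorem cutBd_image {H : V → V → Prop} (σ : Equiv.Perm V) (hσ : ∀ x y, H (σ x) (σ y) ↔ H x y)
    (B : Set V) : cutBd H (σ '' B) = Prod.map σ σ '' cutBd H B := by
  ext ⟨x, y⟩
  constructor
  · rintro ⟨h, ⟨x, hx, rfl⟩, hy⟩
    obtain ⟨y, rfl⟩ := σ.surjective y
    exact ⟨(x, y), ⟨(hσ x y).1 h, hx, fun h => hy ⟨y, h, rfl⟩⟩, rfl⟩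
  · rintro ⟨⟨a, b⟩, ⟨h, ha, hb⟩, he⟩
    simp only [Prod.map_apply, Prod.mk.injEq] at he
    obtain ⟨rfl, rfl⟩ := he
    exact ⟨(hσ a b).2 h, ⟨a, ha, rfl⟩, fun h => hb (by simpa using h)⟩

/-- The image of a pair of filters under a permutation. -/
def mapPair (σ : Equiv.Perm V) (p : Filter V × Filter V) : Filter V × Filter V :=
  (p.1.map σ, p.2.map σ)

theorem separates_image {σ : Equiv.Perm V} {p : Filter V × Filter V} {B : Set V}
    (h : Separates p B) : Separates (mapPair σ p) (σ '' B) := by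
  have key : ∀ {f : Filter V} {X : Set V}, X ∈ f → σ '' X ∈ f.map σ := fun hX => image_mem_map hX
  have hcompl : (σ '' B)ᶜ = σ '' Bᶜ := (Set.image_compl_eq σ.bijective).symm
  unfold Separates
  rw [hcompl]
  exact h.imp (fun h => ⟨key h.1, key h.2⟩) fun h => ⟨key h.1, key h.2⟩

/-- The permutation `σ` preserves the graph and the family of pairs. -/
structure IsAut (S : CutSystem V) (σ : Equiv.Perm V) : Prop where
  adj : ∀ x y, S.H (σ x) (σ y) ↔ S.H x y
  pairs : ∀ p ∈ S.pairs, mapPair σ p ∈ S.pairs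
  pairs_symm : ∀ p ∈ S.pairs, mapPair σ.symm p ∈ S.pairs

theorem IsAut.inv {σ : Equiv.Perm V} (h : S.IsAut σ) : S.IsAut σ.symm where
  adj x y := by rw [← h.adj]; simp
  pairs := h.pairs_symm
  pairs_symm := by simpa using h.pairs

theorem IsAut.finite_cutBd {σ : Equiv.Perm V} (h : S.IsAut σ) {B : Set V}
    (hB : (cutBd S.H B).Finite) : (cutBd S.H (σ '' B)).Finite := by
  rw [cutBd_image σ h.adj]; exact hB.image _

theorem IsAut.ncard_cutBd {σ : Equiv.Perm V} (h : S.IsAut σ) (B : Set V) :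
    (cutBd S.H (σ '' B)).ncard = (cutBd S.H B).ncard := by
  rw [cutBd_image σ h.adj, Set.ncard_image_of_injective]
  exact Function.Injective.prodMap σ.injective σ.injective

theorem mapPair_symm_mapPair (σ : Equiv.Perm V) (p : Filter V × Filter V) :
    mapPair σ.symm (mapPair σ p) = p := by
  simp [mapPair, Filter.map_map]

theorem IsAut.mem_minCuts {σ : Equiv.Perm V} (h : S.IsAut σ) {p : Filter V × Filter V} {B : Set V}
    (hB : B ∈ S.minCuts p) : σ '' B ∈ S.minCuts (mapPair σ p) := by
  refine ⟨h.finite_cutBd hB.1, separates_image hB.2.1, fun B' h1 h2 => ?_⟩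
  rw [h.ncard_cutBd, ← h.inv.ncard_cutBd B']
  refine hB.2.2 _ (h.inv.finite_cutBd h1) ?_
  have := separates_image (σ := σ.symm) h2
  rwa [mapPair_symm_mapPair] at this

theorem IsAut.mem_allMinCuts {σ : Equiv.Perm V} (h : S.IsAut σ) {B : Set V}
    (hB : B ∈ S.allMinCuts) : σ '' B ∈ S.allMinCuts := by
  obtain ⟨p, hp, hB⟩ := hB
  exact ⟨_, h.pairs p hp, h.mem_minCuts hB⟩

theorem crossing_image (σ : Equiv.Perm V) {A B : Set V} (h : Crossing A B) :
    Crossing (σ '' A) (σ '' B) := by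
  unfold Crossing at *
  simp only [← Set.image_compl_eq σ.bijective, ← Set.image_inter σ.injective, Set.image_nonempty]
  exact h

theorem symm_image_image (σ : Equiv.Perm V) (A : Set V) : σ.symm '' (σ '' A) = A := by
  rw [← Set.image_comp]; simp

theorem image_symm_image (σ : Equiv.Perm V) (A : Set V) : σ '' (σ.symm '' A) = A := by
  rw [← Set.image_comp]; simp

theorem IsAut.crossings {σ : Equiv.Perm V} (h : S.IsAut σ) (A : Set V) :
    S.crossings (σ '' A) = S.crossings A := by
  unfold CutSystem.crossings
  have : {B | B ∈ S.allMinCuts ∧ Crossing (σ '' A) B} =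
      (fun B => σ '' B) '' {B | B ∈ S.allMinCuts ∧ Crossing A B} := by
    ext B
    constructor
    · rintro ⟨hB, hc⟩
      refine ⟨σ.symm '' B, ⟨h.inv.mem_allMinCuts hB, ?_⟩, image_symm_image σ B⟩
      have := crossing_image σ.symm hc
      rwa [symm_image_image] at this
    · rintro ⟨B, ⟨hB, hc⟩, rfl⟩
      exact ⟨h.mem_allMinCuts hB, crossing_image σ hc⟩
  rw [this, Set.ncard_image_of_injective _ (Set.image_injective.2 σ.injective)]

theorem IsAut.mem_allOptCuts {σ : Equiv.Perm V} (h : S.IsAut σ) {B : Set V}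
    (hB : B ∈ S.allOptCuts) : σ '' B ∈ S.allOptCuts := by
  obtain ⟨p, hp, hB, hmin⟩ := hB
  refine ⟨_, h.pairs p hp, h.mem_minCuts hB, fun C hC => ?_⟩
  rw [h.crossings, ← h.inv.crossings C]
  apply hmin
  have := h.inv.mem_minCuts hC
  rwa [mapPair_symm_mapPair] at this

end CutSystem

end CutSystem

section FixedPoints

variable {G : Type*} [Group G]

theorem smul_pow_ne_of_eventually {l : G} {e : Set G} (h1 : ∀ᶠ n : ℕ in atTop, l ^ n ∈ e)
    (h2 : ∀ᶠ n : ℕ in atTop, l⁻¹ ^ n ∉ e) {d : ℕ} (hd : 0 < d) : l ^ d • e ≠ e := by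
  intro hde
  have hmem : ∀ k : ℕ, ∀ z, l ^ (d * k) * z ∈ e ↔ z ∈ e := by
    intro k
    induction k with
    | zero => simp
    | succ k ih =>
      intro z
      rw [mul_add, pow_add, mul_assoc, ih, mul_one]
      conv_lhs => rw [← hde, Set.mem_smul_set_iff_inv_smul_mem]
      simp
  rw [eventually_atTop] at h1 h2
  obtain ⟨a, ha⟩ := h1
  obtain ⟨b, hb⟩ := h2
  have hk : a + b ≤ d * (a + b) := Nat.le_mul_of_pos_left _ hd
  have e1 := ha (d * (a + b)) (by omega)
  have e2 := hb (d * (a + b)) (by omega)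
  have := hmem (a + b) (l⁻¹ ^ (d * (a + b)))
  rw [inv_pow, mul_inv_cancel] at this
  have h3 := hmem (a + b) 1
  rw [mul_one] at h3
  rw [inv_pow] at e2
  exact e2 (this.1 (h3.1 e1))

/-- A family of cuts which differs from the principal one at finitely many places has trivial
stabilizer, if the powers of any nontrivial element are separated. -/
theorem eq_one_of_orientation_invariant {E : Set (Set G)} (hL : ∀ k : G, ∀ e ∈ E, k • e ∈ E)
    (hsep : ∀ l : G, l ≠ 1 → ∃ e ∈ E, (∀ᶠ n : ℕ in atTop, l ^ n ∈ e) ∧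
      ∀ᶠ n : ℕ in atTop, l⁻¹ ^ n ∉ e)
    {O : Set (Set G)} (hO : {f ∈ E | ¬ (f ∈ O ↔ 1 ∈ f)}.Finite) {l : G}
    (hl : ∀ f ∈ E, (f ∈ O ↔ l • f ∈ O)) : l = 1 := by
  by_contra hne
  obtain ⟨e, he, h1, h2⟩ := hsep l hne
  have hinj : Function.Injective fun n : ℕ => l ^ n • e := by
    intro m n hmn
    wlog hlt : m < n generalizing m n
    · rcases lt_trichotomy m n with h | h | h
      · exact absurd h hlt
      · exact h
      · exact (this hmn.symm h).symm
    refine absurd ?_ (smul_pow_ne_of_eventually h1 h2 (d := n - m) (by omega))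
    have hmn : l ^ m • e = l ^ n • e := hmn
    have : l ^ n = l ^ m * l ^ (n - m) := by rw [← pow_add]; congr 1; omega
    rw [this, mul_smul] at hmn
    exact (MulAction.injective _ hmn).symm
  have hinj' : Function.Injective fun n : ℕ => l⁻¹ ^ n • e := by
    intro m n hmn
    have hmn : l⁻¹ ^ m • e = l⁻¹ ^ n • e := hmn
    apply hinj
    change l ^ m • e = l ^ n • e
    have := congrArg (fun f => l ^ (m + n) • f) hmn
    simp only [smul_smul] at this
    rw [show l ^ (m + n) * l⁻¹ ^ n = l ^ m by rw [pow_add, inv_pow, mul_inv_cancel_right],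
      show l ^ (m + n) * l⁻¹ ^ m = l ^ n by
        rw [add_comm, pow_add, inv_pow, mul_inv_cancel_right] ] at this
    exact this.symm
  have hpow : ∀ n : ℕ, (e ∈ O ↔ l ^ n • e ∈ O) := by
    intro n
    induction n with
    | zero => simp
    | succ n ih => rw [ih, hl _ (hL _ _ he), smul_smul, pow_succ']
  have hpow' : ∀ n : ℕ, (e ∈ O ↔ l⁻¹ ^ n • e ∈ O) := by
    intro n
    induction n with
    | zero => simp
    | succ n ih =>
      rw [ih, hl (l⁻¹ ^ (n + 1) • e) (hL _ _ he), smul_smul, pow_succ', mul_inv_cancel_left]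
  rw [eventually_atTop] at h1 h2
  obtain ⟨a, ha⟩ := h1
  obtain ⟨b, hb⟩ := h2
  by_cases heO : e ∈ O
  · refine Set.infinite_of_injective_forall_mem (s := {f ∈ E | ¬ (f ∈ O ↔ 1 ∈ f)})
      (f := fun n : ℕ => l ^ (n + b) • e)
      (fun m n h => by simpa using hinj h) (fun n => ⟨hL _ _ he, ?_⟩) hO
    have : (1 : G) ∉ l ^ (n + b) • e := by
      rw [Set.mem_smul_set_iff_inv_smul_mem, smul_eq_mul, mul_one, ← inv_pow]
      exact hb _ (by omega)
    have := (hpow (n + b)).1 heO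
    tauto
  · refine Set.infinite_of_injective_forall_mem (s := {f ∈ E | ¬ (f ∈ O ↔ 1 ∈ f)})
      (f := fun n : ℕ => l⁻¹ ^ (n + a) • e)
      (fun m n h => by simpa using hinj' h) (fun n => ⟨hL _ _ he, ?_⟩) hO
    have : (1 : G) ∈ l⁻¹ ^ (n + a) • e := by
      rw [Set.mem_smul_set_iff_inv_smul_mem, smul_eq_mul, mul_one, ← inv_pow, inv_inv]
      exact ha _ (by omega)
    have := mt (hpow' (n + a)).2 heO
    tauto

/-- A monotone bijection of a finite chain of sets is the identity. -/
theorem eq_of_monotone_on_finite_chain {X : Type*} {s : Set (Set X)} (hs : s.Finite)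
    (a b : Set X → Set X) (ha : ∀ e ∈ s, a e ∈ s) (hb : ∀ e ∈ s, b e ∈ s)
    (hma : ∀ e f, e ⊆ f → a e ⊆ a f) (hmb : ∀ e f, e ⊆ f → b e ⊆ b f)
    (hab : ∀ e, a (b e) = e) (hba : ∀ e, b (a e) = e)
    (hchain : ∀ e ∈ s, ∀ f ∈ s, e ⊆ f ∨ f ⊆ e) {e : Set X} (he : e ∈ s) : a e = e := by
  have key : ∀ a b : Set X → Set X, (∀ e ∈ s, a e ∈ s) → (∀ e f, e ⊆ f → a e ⊆ a f) →
      (∀ e, b (a e) = e) → ∀ e ∈ s, a e ⊆ e → a e = e := by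
    intro a b ha hma hba e he h
    by_contra hne
    have h1 : {f ∈ s | f ⊆ a e} ⊂ {f ∈ s | f ⊆ e} := by
      refine (show {f ∈ s | f ⊆ a e} ⊆ {f ∈ s | f ⊆ e} from
        fun f hf => ⟨hf.1, hf.2.trans h⟩).ssubset_of_mem_notMem (a := e) ⟨he, subset_rfl⟩ ?_
      intro h2
      exact hne (subset_antisymm h h2.2)
    have hf1 : {f ∈ s | f ⊆ e}.Finite := hs.subset fun f hf => hf.1
    have h2 := Set.ncard_lt_ncard h1 hf1
    have h3 : ({f ∈ s | f ⊆ e}).ncard ≤ ({f ∈ s | f ⊆ a e}).ncard := by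
      refine Set.ncard_le_ncard_of_injOn a (fun f hf => ⟨ha f hf.1, hma _ _ hf.2⟩) ?_
        (hs.subset fun f hf => hf.1)
      intro f _ f' _ hff
      rw [← hba f, ← hba f', hff]
    omega
  rcases hchain _ (ha e he) e he with h | h
  · exact key a b ha hma hba e he h
  · have := key b a hb hmb hab (a e) (ha e he) (by rw [hba]; exact h)
    rw [hba] at this
    exact this.symm

theorem exists_family_unseparated_iff_fixed (α : G ≃* G)
    (E : Set (Set G)) (hL : ∀ k : G, ∀ e ∈ E, k • e ∈ E) (hc : ∀ e ∈ E, eᶜ ∈ E)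
    (hn : ∀ e ∈ E, ∀ f ∈ E, e ⊆ fᶜ ∨ e ⊆ f ∨ f ⊆ e ∨ eᶜ ⊆ f)
    (hfin : ∀ g : G, {e ∈ E | 1 ∉ e ∧ g ∈ e}.Finite)
    (hα : ∀ e ∈ E, α '' e ∈ E) (hα' : ∀ e ∈ E, α.symm '' e ∈ E)
    (hsep : ∀ l : G, l ≠ 1 → ∃ e ∈ E, (∀ᶠ n : ℕ in atTop, l ^ n ∈ e) ∧
      ∀ᶠ n : ℕ in atTop, l⁻¹ ^ n ∉ e) :
    ∃ E' ⊆ E, (∀ k : G, ∀ e ∈ E', k • e ∈ E') ∧ (∀ e ∈ E', eᶜ ∈ E') ∧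
      ∀ g, (∀ e ∈ E', (1 ∈ e ↔ g ∈ e)) ↔ α g = g := by
  let β : G → Set G → Set G := fun h e => (h * (α h)⁻¹) • (α '' e)
  have hαmem : ∀ (e : Set G) x, α x ∈ α '' e ↔ x ∈ e := fun e x => α.injective.mem_set_image
  have h1α : ∀ e : Set G, 1 ∈ α '' e ↔ 1 ∈ e := fun e => by rw [← hαmem e 1, map_one]
  have hαc : ∀ e : Set G, (α '' e)ᶜ = α '' eᶜ := fun e => (Set.image_compl_eq α.bijective).symm
  have hαs : ∀ e : Set G, α '' (α.symm '' e) = e := fun e => by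
    rw [← Set.image_comp]; simp
  have hαs' : ∀ e : Set G, α.symm '' (α '' e) = e := fun e => by
    rw [← Set.image_comp]; simp
  have hαE : ∀ e, α '' e ∈ E ↔ e ∈ E := fun e =>
    ⟨fun h => by simpa [hαs'] using hα' _ h, hα e⟩
  have hLE : ∀ (k : G) e, k • e ∈ E ↔ e ∈ E := fun k e =>
    ⟨fun h => by simpa using hL k⁻¹ _ h, hL k e⟩
  have hβc : ∀ h e, β h eᶜ = (β h e)ᶜ := fun h e => by
    simp only [β, ← hαc, Set.smul_set_compl]
  have hαk : ∀ (k : G) (e : Set G), α '' (k • e) = α k • (α '' e) := by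
    intro k e
    ext x
    obtain ⟨x, rfl⟩ := α.surjective x
    rw [hαmem, Set.mem_smul_set_iff_inv_smul_mem, Set.mem_smul_set_iff_inv_smul_mem,
      smul_eq_mul, smul_eq_mul, ← map_inv, ← map_mul, hαmem]
  have hβL : ∀ h k e, β h (k • e) = k • β (k⁻¹ * h) e := by
    intro h k e
    simp only [β, hαk, smul_smul, map_mul, map_inv]
    congr 1
    group
  refine ⟨{e | e ∈ E ∧ ∀ h, β h e ≠ e}, fun e he => he.1, ?_, ?_, ?_⟩
  · rintro k e ⟨he, hb⟩
    refine ⟨hL k e he, fun h heq => hb (k⁻¹ * h) ?_⟩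
    rw [hβL] at heq
    exact MulAction.injective k heq
  · rintro e ⟨he, hb⟩
    refine ⟨hc e he, fun h heq => hb h ?_⟩
    rw [hβc] at heq
    exact compl_injective heq
  -- an orientation determined by a finite fixed set
  have horient : ∀ D ⊆ {f | f ∈ E ∧ 1 ∉ f}, D.Finite → (∀ f ∈ D, α '' f = f) →
      let O : Set (Set G) := {f | f ∈ D ∨ (1 ∈ f ∧ fᶜ ∉ D)}
      {f ∈ E | ¬ (f ∈ O ↔ 1 ∈ f)}.Finite ∧ ∀ f, f ∈ O ↔ α '' f ∈ O := by
    intro D hD hDf hDα O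
    have hDα' : ∀ f, α '' f ∈ D ↔ f ∈ D := by
      intro f
      constructor
      · intro h
        have := hDα _ h
        rw [Set.image_injective.2 α.injective this] at h
        exact h
      · intro h; rw [hDα f h]; exact h
    constructor
    · refine (hDf.union (hDf.image compl)).subset ?_
      rintro f ⟨hf, h⟩
      by_cases h1 : f ∈ D
      · exact Or.inl h1
      · right
        refine ⟨fᶜ, ?_, compl_compl f⟩
        by_contra h2
        refine h ⟨fun h3 => ?_, fun h3 => Or.inr ⟨h3, h2⟩⟩
        exact (h3.resolve_left h1).1
    · intro f
      simp only [O, Set.mem_ofPred_eq, hDα', h1α, hαc]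
  intro g
  constructor
  swap
  · intro hg e ⟨he, hb⟩
    by_contra hcon
    wlog hcon1 : 1 ∉ e ∧ g ∈ e generalizing e
    · refine this eᶜ (hc e he) (fun h heq => hb h ?_) (by simp only [Set.mem_compl_iff]; tauto) ?_
      · rw [hβc] at heq
        exact compl_injective heq
      · simp only [Set.mem_compl_iff]; tauto
    apply hb 1
    simp only [β, map_one, inv_one, mul_one, one_smul]
    have hgα : ∀ e : Set G, g ∈ α '' e ↔ g ∈ e := fun e => by rw [← hαmem e g, hg]
    refine eq_of_monotone_on_finite_chain (hfin g) (fun e => α '' e) (fun e => α.symm '' e)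
      ?_ ?_ (fun e f h => Set.image_mono h) (fun e f h => Set.image_mono h) hαs hαs' ?_
      ⟨he, hcon1⟩
    · rintro e ⟨he, h1, h2⟩
      exact ⟨hα e he, by rwa [h1α], by rwa [hgα]⟩
    · rintro e ⟨he, h1, h2⟩
      exact ⟨hα' e he, by rwa [← h1α, hαs], by rwa [← hgα, hαs]⟩
    · rintro e ⟨he, h1, h2⟩ f ⟨hf, h3, h4⟩
      rcases hn e he f hf with h | h | h | h
      · exact absurd h4 (h h2)
      · exact Or.inl h
      · exact Or.inr h
      · exact absurd (h h1) h3
  · intro hg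
    have main : ∀ n : ℕ, ∀ e ∈ E, 1 ∉ e → g ∈ e →
        ({f | f ∈ E ∧ e ⊂ f ∧ 1 ∉ f}).ncard = n → α '' e = e := by
      intro n
      induction n using Nat.strong_induction_on with
      | _ n ih =>
      intro e he h1e hge hcard
      have hfinD : ∀ e : Set G, g ∈ e → {f | f ∈ E ∧ e ⊂ f ∧ 1 ∉ f}.Finite := fun e hge =>
        (hfin g).subset fun f hf => ⟨hf.1, hf.2.2, hf.2.1.1 hge⟩
      obtain ⟨h, hh⟩ : ∃ h, β h e = e := by
        by_contra! hcon
        exact h1e ((hg e ⟨he, hcon⟩).2 hge)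
      have hDα : ∀ f ∈ {f | f ∈ E ∧ e ⊂ f ∧ 1 ∉ f}, α '' f = f := by
        rintro f ⟨hf, hef, h1f⟩
        refine ih _ ?_ f hf h1f (hef.1 hge) rfl
        rw [← hcard]
        refine Set.ncard_lt_ncard ?_ (hfinD e hge)
        refine (show {f' | f' ∈ E ∧ f ⊂ f' ∧ 1 ∉ f'} ⊆ {f | f ∈ E ∧ e ⊂ f ∧ 1 ∉ f} from
          fun f' hf' => ⟨hf'.1, hef.trans hf'.2.1, hf'.2.2⟩).ssubset_of_mem_notMem (a := f)
          ⟨hf, hef, h1f⟩ (fun h => h.2.1.ne rfl)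
      obtain ⟨hOf, hOα⟩ := horient _ (fun f hf => ⟨hf.1, hf.2.2⟩) (hfinD e hge) hDα
      have hO : ∀ f ∈ E, (f ∈ {f | f ∈ {f | f ∈ E ∧ e ⊂ f ∧ 1 ∉ f} ∨
          (1 ∈ f ∧ fᶜ ∉ {f | f ∈ E ∧ e ⊂ f ∧ 1 ∉ f})} ↔ (eᶜ ⊆ f ∨ e ⊂ f)) := by
        intro f hf
        simp only [Set.mem_ofPred_eq, hf, hc f hf, true_and, Set.mem_compl_iff, not_not]
        constructor
        · rintro (⟨h1, h2⟩ | ⟨h1, h2⟩)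
          · exact Or.inr h1
          · have h2 : ¬ e ⊂ fᶜ := fun h => h2 ⟨h, h1⟩
            rcases hn e he f hf with h | h | h | h
            · left
              rw [Set.compl_subset_comm]
              by_contra h3
              exact h2 ⟨h, h3⟩
            · exact Or.inr ⟨h, fun h3 => h1e (h3 h1)⟩
            · exact absurd (h h1) h1e
            · exact Or.inl h
        · intro h
          by_cases h1 : 1 ∈ f
          · right
            refine ⟨h1, fun h2 => ?_⟩
            rcases h with h | h
            · exact h2.1.2 (Set.compl_subset_comm.1 h)
            · exact h2.1.1 hge (h.1 hge)
          · left
            refine ⟨h.resolve_left fun h => h1 (h h1e), h1⟩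
      have hl : h * (α h)⁻¹ = 1 := by
        refine eq_one_of_orientation_invariant hL hsep hOf fun f hf => ?_
        have hf2 : α '' (α.symm '' f) = f := hαs f
        have hf3 := hα' f hf
        rw [← hf2, ← hOα, hO _ hf3, hO _ (hL _ _ (hα _ hf3))]
        have hsub : ∀ a b, β h a ⊆ β h b ↔ a ⊆ b := by
          intro a b
          simp only [β, Set.smul_set_subset_smul_set_iff,
            Set.image_subset_image_iff α.injective]
        change _ ↔ eᶜ ⊆ β h _ ∨ e ⊂ β h _
        have e1 := hsub eᶜ (α.symm '' f)
        have e2 := hsub e (α.symm '' f)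
        have e3 := hsub (α.symm '' f) e
        rw [hβc, hh] at e1
        rw [hh] at e2 e3
        rw [ssubset_iff_subset_not_subset, ssubset_iff_subset_not_subset, e1, e2, e3]
      simpa [β, hl] using hh
    have hDα : ∀ f ∈ {e ∈ E | 1 ∉ e ∧ g ∈ e}, α '' f = f := fun f hf =>
      main _ f hf.1 hf.2.1 hf.2.2 rfl
    obtain ⟨hOf, hOα⟩ := horient _ (fun f hf => ⟨hf.1, hf.2.1⟩) (hfin g) hDα
    have hO : ∀ f ∈ E, (f ∈ {f | f ∈ {e ∈ E | 1 ∉ e ∧ g ∈ e} ∨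
          (1 ∈ f ∧ fᶜ ∉ {e ∈ E | 1 ∉ e ∧ g ∈ e})} ↔ g ∈ f) := by
      intro f hf
      simp only [Set.mem_ofPred_eq, hf, hc f hf, true_and, Set.mem_compl_iff, not_not]
      tauto
    have hl : α g * g⁻¹ = 1 := by
      refine eq_one_of_orientation_invariant hL hsep hOf fun f hf => ?_
      have key : ∀ f ∈ E, (α g ∈ f ↔ g ∈ f) := by
        intro f hf
        have hf3 := hα' f hf
        rw [← hαs f, hαmem, ← hO _ hf3, hOα, hO _ (hα _ hf3)]
      rw [hO _ hf, hO _ (hL _ _ hf), ← key _ (hL _ _ hf), Set.mem_smul_set_iff_inv_smul_mem]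
      simp
    exact mul_inv_eq_one.1 hl

end FixedPoints

section SeparatedGroups

variable {G : Type*} [Group G]

/-- The set of elements at which right translation by `g` crosses the boundary of `B`. -/
def rightBd (B : Set G) (g : G) : Set G := {x | ¬ (x ∈ B ↔ x * g ∈ B)}

/-- Any two opposite ends of an infinite cyclic subgroup are separated by an almost invariant set,
with boundary bounded in terms of the translating element only. -/
def SeparatesPowers (G : Type*) [Group G] : Prop :=
  ∃ κ : G → ℕ, ∀ g : G, g ≠ 1 → ∃ e : Set G,
    (∀ s, (rightBd e s).Finite ∧ (rightBd e s).ncard ≤ κ s) ∧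
    (∀ᶠ n : ℕ in atTop, g ^ n ∈ e) ∧ ∀ᶠ n : ℕ in atTop, g⁻¹ ^ n ∉ e

/-- The Cayley graph relation. -/
def cayley (S : Finset G) (x y : G) : Prop := ∃ s ∈ S, y = x * s

theorem finite_rightBd_of_finite_cutBd {S : Finset G} (hsymm : ∀ s ∈ S, s⁻¹ ∈ S)
    (hS : Subgroup.closure (S : Set G) = ⊤) {B : Set G} (hB : (cutBd (cayley S) B).Finite) (g : G) :
    (rightBd B g).Finite := by
  have hg : g ∈ Subgroup.closure (S : Set G) := by rw [hS]; trivial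
  induction hg using Subgroup.closure_induction with
  | mem s hs =>
    refine ((hB.image Prod.fst).union (hB.image Prod.snd)).subset fun x hx => ?_
    by_cases h : x ∈ B
    · exact Or.inl ⟨(x, x * s), ⟨⟨s, hs, rfl⟩, h, fun h' => hx (by tauto)⟩, rfl⟩
    · refine Or.inr ⟨(x * s, x), ⟨⟨s⁻¹, hsymm s hs, by simp⟩, ?_, h⟩, rfl⟩
      by_contra h'
      exact hx (by tauto)
  | one => simp [rightBd]
  | mul g h _ _ ihg ihh =>
    refine (ihg.union (ihh.preimage (f := fun x => x * g)
      ((mul_left_injective g).injOn))).subset fun x hx => ?_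
    simp only [rightBd, Set.mem_ofPred_eq, Set.mem_union, Set.mem_preimage, ← mul_assoc] at hx ⊢
    tauto
  | inv g _ ihg =>
    refine (ihg.preimage (f := fun x => x * g⁻¹) ((mul_left_injective _).injOn)).subset
      fun x hx => ?_
    simp only [rightBd, Set.mem_ofPred_eq, Set.mem_preimage, inv_mul_cancel_right] at hx ⊢
    tauto

theorem injective_mul_pow (tf : ∀ (g : G) (n : ℕ), 0 < n → g ^ n = 1 → g = 1) (h : G) {g : G}
    (hg : g ≠ 1) : Function.Injective fun n : ℕ => h * g ^ n := by
  intro m n hmn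
  have : g ^ m = g ^ n := mul_left_cancel hmn
  wlog hlt : m < n generalizing m n
  · rcases lt_trichotomy m n with h' | h' | h'
    · exact absurd h' hlt
    · exact h'
    · exact (this hmn.symm ‹g ^ m = g ^ n›.symm h').symm
  refine absurd (tf g (n - m) (by omega) ?_) hg
  rw [pow_sub g hlt.le, this, mul_inv_cancel]

theorem eventually_mem_or_of_finite_rightBd
    (tf : ∀ (g : G) (n : ℕ), 0 < n → g ^ n = 1 → g = 1) {B : Set G} (h : G) {g : G}
    (hg : g ≠ 1) (hB : (rightBd B g).Finite) :
    (∀ᶠ n : ℕ in atTop, h * g ^ n ∈ B) ∨ ∀ᶠ n : ℕ in atTop, h * g ^ n ∈ Bᶜ := by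
  have h1 := hB.preimage (f := fun n : ℕ => h * g ^ n) (injective_mul_pow tf h hg).injOn
  obtain ⟨N, hN⟩ := h1.bddAbove
  have hstep : ∀ n, N < n → (h * g ^ n ∈ B ↔ h * g ^ (n + 1) ∈ B) := by
    intro n hn
    by_contra hcon
    refine absurd (hN (a := n) ?_) (by omega)
    rw [pow_succ, ← mul_assoc] at hcon
    exact hcon
  have hall : ∀ k, (h * g ^ (N + 1) ∈ B ↔ h * g ^ (N + 1 + k) ∈ B) := by
    intro k
    induction k with
    | zero => rfl
    | succ k ih => rw [ih, hstep _ (by omega)]; rfl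
  by_cases hm : h * g ^ (N + 1) ∈ B
  · left
    filter_upwards [eventually_ge_atTop (N + 1)] with n hn
    obtain ⟨k, rfl⟩ := Nat.exists_eq_add_of_le hn
    exact (hall k).1 hm
  · right
    filter_upwards [eventually_ge_atTop (N + 1)] with n hn
    obtain ⟨k, rfl⟩ := Nat.exists_eq_add_of_le hn
    exact fun h' => hm ((hall k).2 h')

theorem cutConnected_cayley {S : Finset G} (hsymm : ∀ s ∈ S, s⁻¹ ∈ S)
    (hS : Subgroup.closure (S : Set G) = ⊤) : CutConnected (cayley S) := by
  intro P hP
  have hP' : ∀ x ∈ P, ∀ s ∈ S, x * s ∈ P := by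
    intro x hx s hs
    by_contra h
    have : (x, x * s) ∈ cutBd (cayley S) P := ⟨⟨s, hs, rfl⟩, hx, h⟩
    rw [hP] at this
    exact this
  have hall : ∀ g, ∀ x ∈ P, x * g ∈ P := by
    intro g
    have hg : g ∈ Subgroup.closure (S : Set G) := by rw [hS]; trivial
    induction hg using Subgroup.closure_induction'' with
    | mem s hs => exact fun x hx => hP' x hx s hs
    | inv_mem s hs => exact fun x hx => hP' x hx _ (hsymm s hs)
    | one => simp
    | mul g h _ _ ihg ihh =>
      intro x hx
      rw [← mul_assoc]
      exact ihh _ (ihg _ hx)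
  rcases P.eq_empty_or_nonempty with h | ⟨x, hx⟩
  · exact Or.inl h
  · right
    ext y
    simpa using hall (x⁻¹ * y) x hx

theorem ncard_cutBd_cayley_le {S : Finset G} {B : Set G} {κ : G → ℕ}
    (h : ∀ s, (rightBd B s).Finite ∧ (rightBd B s).ncard ≤ κ s) :
    (cutBd (cayley S) B).Finite ∧ (cutBd (cayley S) B).ncard ≤ ∑ s ∈ S, κ s := by
  classical
  have hsub : cutBd (cayley S) B ⊆
      ((S.biUnion fun s => (h s).1.toFinset.image fun x => (x, x * s) : Finset (G × G)) :
        Set (G × G)) := by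
    rintro ⟨x, y⟩ ⟨⟨s, hs, h1⟩, h2, h3⟩
    simp only at h1 h2 h3
    subst h1
    simp only [Finset.coe_biUnion, Set.mem_iUnion]
    refine ⟨s, hs, ?_⟩
    simp only [Finset.coe_image, Set.Finite.coe_toFinset]
    exact ⟨x, by simp [rightBd, h2, h3], rfl⟩
  refine ⟨(Finset.finite_toSet _).subset hsub,
    (Set.ncard_le_ncard hsub (Finset.finite_toSet _)).trans ?_⟩
  rw [Set.ncard_coe_finset]
  refine Finset.card_biUnion_le.trans (Finset.sum_le_sum fun s _ => Finset.card_image_le.trans ?_)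
  rw [← Set.ncard_eq_toFinset_card _ (h s).1]
  exact (h s).2

/-- The cut system of opposite ends of infinite cyclic subgroups. -/
noncomputable def powerCutSystem (tf : ∀ (g : G) (n : ℕ), 0 < n → g ^ n = 1 → g = 1)
    (S : Finset G) (hsymm : ∀ s ∈ S, s⁻¹ ∈ S) (hS : Subgroup.closure (S : Set G) = ⊤)
    (hG : SeparatesPowers G) : CutSystem G where
  H := cayley S
  symm := by
    rintro x _ ⟨s, hs, rfl⟩
    exact ⟨s⁻¹, hsymm s hs, by simp⟩
  conn := cutConnected_cayley hsymm hS
  pairs := {p | ∃ h g : G, g ≠ 1 ∧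
    p = (map (fun n : ℕ => h * g ^ n) atTop, map (fun n : ℕ => h * g⁻¹ ^ n) atTop)}
  neBot_fst := by
    rintro _ ⟨h, g, -, rfl⟩
    exact map_neBot
  neBot_snd := by
    rintro _ ⟨h, g, -, rfl⟩
    exact map_neBot
  decides_fst := by
    rintro _ ⟨h, g, hg, rfl⟩ B hB
    exact eventually_mem_or_of_finite_rightBd tf h hg
      (finite_rightBd_of_finite_cutBd hsymm hS hB g)
  decides_snd := by
    rintro _ ⟨h, g, hg, rfl⟩ B hB
    exact eventually_mem_or_of_finite_rightBd tf h (inv_ne_one.2 hg)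
      (finite_rightBd_of_finite_cutBd hsymm hS hB g⁻¹)
  bound := ∑ s ∈ S, hG.choose s
  exists_cut := by
    rintro _ ⟨h, g, hg, rfl⟩
    obtain ⟨e, he, h1, h2⟩ := hG.choose_spec g hg
    have hbd : ∀ s, rightBd (h • e) s = h • rightBd e s := by
      intro s
      ext x
      simp [rightBd, Set.mem_smul_set_iff_inv_smul_mem, mul_assoc]
    have hbd' : ∀ s, (rightBd (h • e) s).Finite ∧ (rightBd (h • e) s).ncard ≤ hG.choose s := by
      intro s
      rw [hbd]
      refine ⟨(he s).1.smul_set, ?_⟩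
      have : h • rightBd e s = (fun x => h * x) '' rightBd e s := rfl
      rw [this, Set.ncard_image_of_injective _ (mul_right_injective h)]
      exact (he s).2
    obtain ⟨h3, h4⟩ := ncard_cutBd_cayley_le (S := S) hbd'
    refine ⟨h • e, h3, h4, Or.inl ⟨?_, ?_⟩⟩
    · rw [mem_map]
      filter_upwards [h1] with n hn
      simpa [Set.mem_smul_set_iff_inv_smul_mem] using hn
    · rw [mem_map]
      filter_upwards [h2] with n hn
      simpa [Set.mem_smul_set_iff_inv_smul_mem] using hn

theorem isAut_powerCutSystem_mulLeft (tf : ∀ (g : G) (n : ℕ), 0 < n → g ^ n = 1 → g = 1)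
    (S : Finset G) (hsymm : ∀ s ∈ S, s⁻¹ ∈ S) (hS : Subgroup.closure (S : Set G) = ⊤)
    (hG : SeparatesPowers G) (k : G) :
    (powerCutSystem tf S hsymm hS hG).IsAut (Equiv.mulLeft k) := by
  have hp : ∀ k : G, ∀ p ∈ (powerCutSystem tf S hsymm hS hG).pairs,
      CutSystem.mapPair (Equiv.mulLeft k) p ∈ (powerCutSystem tf S hsymm hS hG).pairs := by
    rintro k _ ⟨h, g, hg, rfl⟩
    refine ⟨k * h, g, hg, ?_⟩
    simp only [CutSystem.mapPair, Filter.map_map, Prod.mk.injEq]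
    constructor <;> congr 1 <;> ext n <;> simp [mul_assoc]
  refine ⟨fun x y => ?_, hp k, ?_⟩
  · change (∃ s ∈ S, k * y = k * x * s) ↔ ∃ s ∈ S, y = x * s
    simp [mul_assoc]
  · rw [Equiv.mulLeft_symm]
    exact hp k⁻¹

theorem isAut_powerCutSystem_mulEquiv (tf : ∀ (g : G) (n : ℕ), 0 < n → g ^ n = 1 → g = 1)
    (S : Finset G) (hsymm : ∀ s ∈ S, s⁻¹ ∈ S) (hS : Subgroup.closure (S : Set G) = ⊤)
    (hG : SeparatesPowers G) (α : G ≃* G) (hα : ∀ s, α s ∈ S ↔ s ∈ S) :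
    (powerCutSystem tf S hsymm hS hG).IsAut α.toEquiv := by
  have hp : ∀ α : G ≃* G, ∀ p ∈ (powerCutSystem tf S hsymm hS hG).pairs,
      CutSystem.mapPair α.toEquiv p ∈ (powerCutSystem tf S hsymm hS hG).pairs := by
    rintro α _ ⟨h, g, hg, rfl⟩
    refine ⟨α h, α g, by simpa using hg, ?_⟩
    simp only [CutSystem.mapPair, Filter.map_map, Prod.mk.injEq]
    constructor <;> congr 1 <;> ext n <;> simp
  refine ⟨fun x y => ?_, hp α, hp α.symm⟩
  change (∃ s ∈ S, α y = α x * s) ↔ ∃ s ∈ S, y = x * s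
  constructor
  · rintro ⟨s, hs, h⟩
    obtain ⟨s, rfl⟩ := α.surjective s
    exact ⟨s, (hα s).1 hs, α.injective (by simpa using h)⟩
  · rintro ⟨s, hs, rfl⟩
    exact ⟨α s, (hα s).2 hs, by simp⟩

theorem exists_invariant_generating_set [Group.FG G] (α : G ≃* G) {N : ℕ} (hN : 0 < N)
    (hα : ∀ g, (α^[N]) g = g) :
    ∃ S : Finset G, (∀ s ∈ S, s⁻¹ ∈ S) ∧ Subgroup.closure (S : Set G) = ⊤ ∧
      ∀ s, α s ∈ S ↔ s ∈ S := by
  classical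
  obtain ⟨S₀, hS₀⟩ := (Group.fg_def.1 ‹_› : (⊤ : Subgroup G).FG)
  let S₁ : Finset G := S₀ ∪ S₀.image (·⁻¹)
  have hS₁ : ∀ s ∈ S₁, s⁻¹ ∈ S₁ := by
    intro s hs
    simp only [S₁, Finset.mem_union, Finset.mem_image] at hs ⊢
    rcases hs with h | ⟨a, ha, rfl⟩
    · exact Or.inr ⟨s, h, rfl⟩
    · exact Or.inl (by simpa using ha)
  let S : Finset G := (Finset.range N).biUnion fun i => S₁.image (α^[i])
  have hS : ∀ s, s ∈ S ↔ ∃ i < N, ∃ a ∈ S₁, (α^[i]) a = s := by simp [S]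
  have hfwd : ∀ s ∈ S, α s ∈ S := by
    intro s hs
    rw [hS] at hs ⊢
    obtain ⟨i, hi, a, ha, rfl⟩ := hs
    by_cases h : i + 1 < N
    · exact ⟨i + 1, h, a, ha, Function.iterate_succ_apply' _ _ _⟩
    · refine ⟨0, hN, a, ha, ?_⟩
      rw [← Function.iterate_succ_apply' α, show i.succ = N by omega, hα]
      rfl
  refine ⟨S, fun s hs => ?_, ?_, fun s => ⟨fun h => ?_, hfwd s⟩⟩
  · rw [hS] at hs ⊢
    obtain ⟨i, hi, a, ha, rfl⟩ := hs
    exact ⟨i, hi, a⁻¹, hS₁ a ha, iterate_map_inv α i a⟩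
  · rw [eq_top_iff, ← hS₀]
    refine Subgroup.closure_mono fun s hs => ?_
    rw [Finset.mem_coe, hS]
    exact ⟨0, hN, s, by simp [S₁, Finset.mem_coe.1 hs], rfl⟩
  · have hit : ∀ (i : ℕ) s, s ∈ S → (α^[i]) s ∈ S := by
      intro i
      induction i with
      | zero => exact fun s hs => hs
      | succ i ih => exact fun s hs => ih _ (hfwd s hs)
    have := hit (N - 1) _ h
    rw [← Function.iterate_succ_apply, show (N - 1).succ = N by omega, hα] at this
    exact this

/-- The fixed subgroup of a periodic automorphism of a finitely generated group whose powers are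
separated is a free factor of the group, and this remains true in all subgroups. -/
theorem isFreeFactorOf_inf_fixed [Group.FG G]
    (tf : ∀ (g : G) (n : ℕ), 0 < n → g ^ n = 1 → g = 1) (hG : SeparatesPowers G)
    (α : G ≃* G) {N : ℕ} (hN : 0 < N) (hα : ∀ g, (α^[N]) g = g) (K : Subgroup G) :
    IsFreeFactorOf (K ⊓ α.toMonoidHom.eqLocus (MonoidHom.id G)) K := by
  obtain ⟨S, hsymm, hS, hSα⟩ := exists_invariant_generating_set α hN hα
  let C := powerCutSystem tf S hsymm hS hG
  have hL : ∀ k : G, ∀ e ∈ C.allOptCuts, k • e ∈ C.allOptCuts := fun k e he =>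
    (isAut_powerCutSystem_mulLeft tf S hsymm hS hG k).mem_allOptCuts he
  have hc : ∀ e ∈ C.allOptCuts, eᶜ ∈ C.allOptCuts := by
    rintro e ⟨p, hp, he⟩
    exact ⟨p, hp, CutSystem.compl_mem_optCuts he⟩
  have hn : ∀ e ∈ C.allOptCuts, ∀ f ∈ C.allOptCuts, e ⊆ fᶜ ∨ e ⊆ f ∨ f ⊆ e ∨ eᶜ ⊆ f := by
    rintro e ⟨p, hp, he⟩ f ⟨q, hq, hf⟩
    have := CutSystem.not_crossing_of_mem_optCuts hp hq he hf
    contrapose! this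
    obtain ⟨h1, h2, h3, h4⟩ := this
    rw [Set.not_subset] at h1 h2 h3 h4
    obtain ⟨a, ha, ha'⟩ := h1
    obtain ⟨b, hb, hb'⟩ := h2
    obtain ⟨c, hc, hc'⟩ := h3
    obtain ⟨d, hd, hd'⟩ := h4
    exact ⟨⟨a, ha, not_not.1 ha'⟩, ⟨b, hb, hb'⟩, ⟨c, hc', hc⟩, ⟨d, hd, hd'⟩⟩
  have hmin : ∀ e ∈ C.allOptCuts, e ∈ C.allMinCuts := by
    rintro e ⟨p, hp, he⟩
    exact ⟨p, hp, he.1⟩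
  have hfin : ∀ g h : G, {e ∈ C.allOptCuts | h ∉ e ∧ g ∈ e}.Finite := fun g h =>
    (CutSystem.finite_minCuts_separating C g h).subset fun e he => ⟨hmin e he.1, he.2.2, he.2.1⟩
  have har : ∀ e ∈ C.allOptCuts, ∀ g, (rightBd e g).Finite := by
    rintro e ⟨p, hp, he⟩ g
    exact finite_rightBd_of_finite_cutBd hsymm hS he.1.1 g
  have haut := isAut_powerCutSystem_mulEquiv tf S hsymm hS hG α hSα
  have hsep : ∀ l : G, l ≠ 1 → ∃ e ∈ C.allOptCuts, (∀ᶠ n : ℕ in atTop, l ^ n ∈ e) ∧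
      ∀ᶠ n : ℕ in atTop, l⁻¹ ^ n ∉ e := by
    intro l hl
    have hp : (map (fun n : ℕ => 1 * l ^ n) atTop, map (fun n : ℕ => 1 * l⁻¹ ^ n) atTop) ∈
        C.pairs :=
      ⟨1, l, hl, rfl⟩
    obtain ⟨e, he⟩ := CutSystem.exists_mem_optCuts hp
    have hsep := he.1.2.1
    simp only [Separates, mem_map, Set.preimage, one_mul] at hsep
    rcases hsep with ⟨h1, h2⟩ | ⟨h1, h2⟩
    · exact ⟨e, ⟨_, hp, he⟩, h1, h2⟩
    · refine ⟨eᶜ, ⟨_, hp, CutSystem.compl_mem_optCuts he⟩, h1, ?_⟩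
      simpa using h2
  obtain ⟨E, hE, hEL, hEc, hEf⟩ := exists_family_unseparated_iff_fixed α C.allOptCuts hL hc hn
    (fun g => hfin g 1) (fun e he => haut.mem_allOptCuts he)
    (fun e he => haut.inv.mem_allOptCuts he) hsep
  let EK : Set (Set K) := (fun e => Subtype.val ⁻¹' e) '' E
  have hELK : ∀ k : K, ∀ e ∈ EK, k • e ∈ EK := by
    rintro k _ ⟨e, he, rfl⟩
    refine ⟨(k : G) • e, hEL _ _ he, ?_⟩
    ext x
    simp [Set.mem_smul_set_iff_inv_smul_mem]
  have key : IsFreeFactorOf (unseparated EK hELK) ⊤ := by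
    refine exists_freeComplement_unseparated ?_ EK hELK ?_ ?_ ?_ ?_
    · intro g n hn hg
      exact Subtype.ext (tf g n hn (by exact_mod_cast congrArg Subtype.val hg))
    · rintro _ ⟨e, he, rfl⟩
      exact ⟨eᶜ, hEc _ he, rfl⟩
    · rintro _ ⟨e, he, rfl⟩ _ ⟨f, hf, rfl⟩
      rcases hn e (hE he) f (hE hf) with h | h | h | h
      · exact Or.inl fun x hx => h hx
      · exact Or.inr (Or.inl fun x hx => h hx)
      · exact Or.inr (Or.inr (Or.inl fun x hx => h hx))
      · exact Or.inr (Or.inr (Or.inr fun x hx => h hx))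
    · rintro _ ⟨e, he, rfl⟩ g
      exact (har e (hE he) g).preimage Subtype.val_injective.injOn
    · intro g
      refine ((hfin g 1).image fun e => (Subtype.val ⁻¹' e : Set K)).subset ?_
      rintro _ ⟨⟨e, he, rfl⟩, h1, h2⟩
      exact ⟨e, ⟨hE he, h1, h2⟩, rfl⟩
  have := key.map K.subtype K.subtype_injective
  rw [← MonoidHom.range_eq_map, K.range_subtype] at this
  convert this using 1
  ext g
  have heq : g ∈ α.toMonoidHom.eqLocus (MonoidHom.id G) ↔ α g = g := Iff.rfl
  simp only [Subgroup.mem_inf, heq, Subgroup.mem_map, mem_unseparated, EK,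
    Set.forall_mem_image]
  constructor
  · rintro ⟨hg, hf⟩
    exact ⟨⟨g, hg⟩, fun e he => (hEf g).2 hf e he, rfl⟩
  · rintro ⟨g, h, rfl⟩
    exact ⟨g.2, (hEf g).1 fun e he => h he⟩

end SeparatedGroups

section SeparatedGroups

variable {G : Type*} [Group G]

theorem SeparatesPowers.subgroup (hG : SeparatesPowers G) (K : Subgroup G) : SeparatesPowers K := by
  obtain ⟨κ, h⟩ := hG
  refine ⟨fun g => κ g, fun g hg => ?_⟩
  obtain ⟨e, he, h1, h2⟩ := h g (by simpa using hg)
  refine ⟨Subtype.val ⁻¹' e, fun s => ?_, by simpa using h1, by simpa using h2⟩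
  have hs : rightBd (Subtype.val ⁻¹' e : Set K) s = Subtype.val ⁻¹' rightBd e s := rfl
  rw [hs]
  refine ⟨(he s).1.preimage Subtype.val_injective.injOn, le_trans ?_ (he s).2⟩
  rw [← Set.ncard_image_of_injective _ Subtype.val_injective]
  exact Set.ncard_le_ncard (Set.image_preimage_subset _ _) (he s).1

theorem finite_rightBd_of_closure {S : Set G} (hS : Subgroup.closure S = ⊤) {B : Set G}
    (hB : ∀ s ∈ S, (rightBd B s).Finite) (g : G) : (rightBd B g).Finite := by
  have hg : g ∈ Subgroup.closure S := by rw [hS]; trivial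
  induction hg using Subgroup.closure_induction with
  | mem s hs => exact hB s hs
  | one => simp [rightBd]
  | mul g h _ _ ihg ihh =>
    refine (ihg.union (ihh.preimage (f := fun x => x * g)
      ((mul_left_injective g).injOn))).subset fun x hx => ?_
    simp only [rightBd, Set.mem_ofPred_eq, Set.mem_union, Set.mem_preimage, ← mul_assoc] at hx ⊢
    tauto
  | inv g _ ihg =>
    refine (ihg.preimage (f := fun x => x * g⁻¹) ((mul_left_injective _).injOn)).subset
      fun x hx => ?_
    simp only [rightBd, Set.mem_ofPred_eq, Set.mem_preimage, inv_mul_cancel_right] at hx ⊢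
    tauto

end SeparatedGroups

namespace FreeGroup

variable {ι : Type*} [DecidableEq ι]

/-- Reduced words with prescribed first letter. -/
def cone (a : ι × Bool) : Set (FreeGroup ι) := {x | x.toWord.head? = some a}

theorem toWord_mul_mk_singleton (x : FreeGroup ι) (b : ι × Bool) :
    x.toWord = (x * mk [b]).toWord ++ [(b.1, !b.2)] ∨ (x * mk [b]).toWord = x.toWord ++ [b] := by
  by_cases h : IsReduced (x.toWord ++ [b])
  · right
    rw [← h.reduce_eq, toWord_mul, toWord_mk, reduce_singleton]
  · left
    rw [IsReduced, List.isChain_append] at h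
    have hx : List.IsChain _ x.toWord := isReduced_toWord (x := x)
    simp only [hx, true_and, List.isChain_singleton, List.head?_cons, Option.mem_def,
      Option.some.injEq, forall_eq'] at h
    push Not at h
    obtain ⟨c, hc, h1, h2⟩ := h
    obtain ⟨L, hL⟩ := List.getLast?_eq_some_iff.1 hc
    have hcb : c = (b.1, !b.2) := by
      refine Prod.ext h1 ?_
      cases hb : b.2 <;> cases hc : c.2 <;> simp_all
    have hmul : x * mk [b] = mk L := by
      rw [← mk_toWord (x := x), hL, ← mul_mk, mul_assoc, hcb,
        show mk [(b.1, !b.2)] = (mk [b])⁻¹ by simp [inv_mk, invRev], inv_mul_cancel, mul_one]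
    have hLr : IsReduced L := (hL ▸ isReduced_toWord (x := x) : IsReduced (L ++ [c])).left_of_append
    rw [hmul, toWord_mk, hLr.reduce_eq, hL, hcb]

theorem finite_rightBd_cone [Finite ι] (a : ι × Bool) (g : FreeGroup ι) :
    (rightBd (cone a) g).Finite := by
  refine finite_rightBd_of_closure (closure_range_of ι) ?_ g
  rintro _ ⟨i, rfl⟩
  refine (((Set.finite_range fun b : ι × Bool => mk [b]).union
    (Set.finite_singleton (1 : FreeGroup ι)))).subset fun x hx => ?_
  simp only [rightBd, cone, Set.mem_ofPred_eq] at hx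
  have hsmall : x.toWord.length ≤ 1 := by
    by_contra! h
    rcases toWord_mul_mk_singleton x (i, true) with h' | h'
    · change x.toWord = (x * of i).toWord ++ _ at h'
      have : (x * of i).toWord ≠ [] := by
        intro h0
        rw [h0] at h'
        simp [h'] at h
      exact hx (by rw [h', List.head?_append_of_ne_nil _ this])
    · change (x * of i).toWord = _ at h'
      have : x.toWord ≠ [] := by
        intro h0
        simp [h0] at h
      exact hx (by rw [h', List.head?_append_of_ne_nil _ this])
  rcases hw : x.toWord with _ | ⟨b, _ | ⟨c, L⟩⟩
  · right
    exact toWord_eq_nil_iff.1 hw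
  · left
    exact ⟨b, by rw [← mk_toWord (x := x), hw]⟩
  · simp [hw] at hsmall

theorem separatesPowers [Finite ι] : SeparatesPowers (FreeGroup ι) := by
  have := Fintype.ofFinite ι
  refine ⟨fun s => ∑ a : ι × Bool, (rightBd (cone a) s).ncard, fun g hg => ?_⟩
  set L := g.toWord with hL
  set u := mk (reduceCyclically.conjugator L) with hu
  set c := reduceCyclically L with hc
  have hcr : IsCyclicallyReduced c := reduceCyclically.isCyclicallyReduced isReduced_toWord
  have hg' : g = u * mk c * u⁻¹ := by
    conv_lhs => rw [← mk_toWord (x := g), ← hL,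
      ← reduceCyclically.conj_conjugator_reduceCyclically L]
    rw [← mul_mk, ← mul_mk, ← inv_mk]
  have hpow : ∀ n, (mk c ^ n).toWord = (List.replicate n c).flatten := by
    intro n
    rw [toWord_pow, toWord_mk, hcr.isReduced.reduce_eq,
      (hcr.flatten_replicate n).isReduced.reduce_eq]
  have hcne : c ≠ [] := by
    rintro h
    rw [h] at hg'
    exact hg (by rw [hg', ← one_eq_mk]; simp)
  obtain ⟨a, hca⟩ : ∃ a, c.head? = some a := by
    rw [← Option.isSome_iff_exists]; simpa using hcne
  obtain ⟨b, hcb⟩ : ∃ b, c.getLast? = some b := by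
    rw [← Option.isSome_iff_exists]; simpa using hcne
  have hgu : ∀ n : ℕ, u⁻¹ * g ^ n * u = mk c ^ n := by
    intro n; rw [hg', conj_pow]; group
  have hlast : Tendsto (fun n : ℕ => (mk c ^ n)) atTop cofinite := by
    have hinj : Function.Injective fun n : ℕ => mk c ^ n := by
      simpa using injective_mul_pow (fun g n hn h => (pow_eq_one_iff_left hn.ne').1 h) 1
        (g := mk c) (fun h => hg (by rw [hg', h]; simp))
    rw [← Nat.cofinite_eq_atTop]
    exact hinj.tendsto_cofinite
  have hcone : ∀ n : ℕ, mk c ^ (n + 1) ∈ cone a := by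
    intro n
    simp only [cone, Set.mem_ofPred_eq, hpow, List.replicate_succ, List.flatten_cons]
    rw [List.head?_append_of_ne_nil _ hcne, hca]
  have hcone' : ∀ n : ℕ, (mk c)⁻¹ ^ (n + 1) ∉ cone a := by
    intro n h
    simp only [cone, Set.mem_ofPred_eq, inv_pow, toWord_inv, hpow] at h
    rw [List.replicate_succ', List.flatten_append, invRev_append] at h
    simp only [List.flatten_cons, List.flatten_nil, List.append_nil] at h
    obtain ⟨M, hM⟩ := List.getLast?_eq_some_iff.1 hcb
    rw [hM, invRev_append] at h
    simp only [invRev, List.map_cons, List.map_nil, List.reverse_cons, List.reverse_nil,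
      List.nil_append, List.cons_append, List.head?_cons, Option.some.injEq] at h
    have := hcr.2 b hcb a hca (by rw [← h])
    rw [← h] at this
    simp at this
  have hbd : ∀ᶠ n : ℕ in atTop, (mk c ^ n ∈ cone a ↔ mk c ^ n * u⁻¹ ∈ cone a) := by
    have := hlast.eventually (finite_rightBd_cone a u⁻¹).eventually_cofinite_notMem
    filter_upwards [this] with n hn
    simpa [rightBd] using hn
  have hbd' : ∀ᶠ n : ℕ in atTop, ((mk c)⁻¹ ^ n ∈ cone a ↔ (mk c)⁻¹ ^ n * u⁻¹ ∈ cone a) := by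
    have hinv : Tendsto (fun x : FreeGroup ι => x⁻¹) cofinite cofinite :=
      inv_injective.tendsto_cofinite
    have := (hinv.comp hlast).eventually (finite_rightBd_cone a u⁻¹).eventually_cofinite_notMem
    filter_upwards [this] with n hn
    rw [inv_pow]
    exact not_not.1 hn
  refine ⟨u • cone a, fun s => ?_, ?_, ?_⟩
  · have hs : rightBd (u • cone a) s = (fun x => u * x) '' rightBd (cone a) s := by
      change _ = u • rightBd (cone a) s
      ext x
      simp [rightBd, Set.mem_smul_set_iff_inv_smul_mem, mul_assoc]
    rw [hs, Set.ncard_image_of_injective _ (mul_right_injective u)]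
    exact ⟨(finite_rightBd_cone a s).image _,
      Finset.single_le_sum (f := fun a => (rightBd (cone a) s).ncard) (fun _ _ => Nat.zero_le _)
        (Finset.mem_univ a)⟩
  · filter_upwards [hbd, eventually_ge_atTop 1] with n hn h1
    obtain ⟨n, rfl⟩ := Nat.exists_eq_add_of_le' h1
    have := hn.1 (hcone n)
    rwa [← hgu, mul_inv_cancel_right, ← smul_eq_mul, ← Set.mem_smul_set_iff_inv_smul_mem] at this
  · filter_upwards [hbd', eventually_ge_atTop 1] with n hn h1
    obtain ⟨n, rfl⟩ := Nat.exists_eq_add_of_le' h1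
    have := mt hn.2 (hcone' n)
    rw [Set.mem_smul_set_iff_inv_smul_mem, smul_eq_mul]
    have h2 : u⁻¹ * g⁻¹ ^ (n + 1) = (mk c)⁻¹ ^ (n + 1) * u⁻¹ := by
      rw [inv_pow, inv_pow, ← hgu]; group
    rwa [h2]

end FreeGroup

section FlowStabilizer

variable {G V : Type*} [Group G] [MulAction G V]

/-- The element of the group which moves `v` along `k` steps of the flow `v ↦ ℓ v • v`. -/
def flowLabel (ℓ : V → G) : ℕ → V → G
  | 0, _ => 1
  | k + 1, v => flowLabel ℓ k (ℓ v • v) * ℓ v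

variable {ℓ : V → G}

theorem flowLabel_smul (k : ℕ) (v : V) : flowLabel ℓ k v • v = (fun v => ℓ v • v)^[k] v := by
  induction k generalizing v with
  | zero => simp [flowLabel]
  | succ k ih => rw [flowLabel, mul_smul, ih, Function.iterate_succ_apply]

theorem flowLabel_add (i j : ℕ) (v : V) :
    flowLabel ℓ (i + j) v = flowLabel ℓ j ((fun v => ℓ v • v)^[i] v) * flowLabel ℓ i v := by
  induction i generalizing v with
  | zero => simp [flowLabel]
  | succ i ih =>
    rw [show i + 1 + j = i + j + 1 by ring, flowLabel, ih, flowLabel, Function.iterate_succ_apply,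
      mul_assoc]

/-- The elements moving `u` to `v` along flow lines. -/
def flowHom (ℓ : V → G) (u v : V) : Set G :=
  {h | ∃ i j, (fun v => ℓ v • v)^[i] u = (fun v => ℓ v • v)^[j] v ∧
    h = (flowLabel ℓ j v)⁻¹ * flowLabel ℓ i u}

theorem smul_eq_of_mem_flowHom {u v : V} {h : G} (hh : h ∈ flowHom ℓ u v) : h • u = v := by
  obtain ⟨i, j, hij, rfl⟩ := hh
  rw [mul_smul, flowLabel_smul, hij, ← flowLabel_smul, inv_smul_smul]

theorem one_mem_flowHom (v : V) : (1 : G) ∈ flowHom ℓ v v := ⟨0, 0, rfl, by simp [flowLabel]⟩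

theorem label_mul_mem_flowHom {u v : V} {h : G} (hh : h ∈ flowHom ℓ u v) :
    ℓ v * h ∈ flowHom ℓ u (ℓ v • v) := by
  obtain ⟨i, j, hij, rfl⟩ := hh
  cases j with
  | zero =>
    refine ⟨i + 1, 0, ?_, ?_⟩
    · rw [Function.iterate_succ_apply', hij]; rfl
    · rw [flowLabel_add, hij]; simp [flowLabel]
  | succ j =>
    refine ⟨i, j, hij, ?_⟩
    rw [flowLabel]; group

theorem mul_mem_flowHom_of_label {u v : V} {h s : G} (hh : h ∈ flowHom ℓ u v)
    (hs : ℓ (s • v) = s⁻¹) : s * h ∈ flowHom ℓ u (s • v) := by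
  obtain ⟨i, j, hij, rfl⟩ := hh
  refine ⟨i, j + 1, ?_, ?_⟩
  · rw [Function.iterate_succ_apply]
    simp only [hs, inv_smul_smul]
    exact hij
  · rw [flowLabel, hs, inv_smul_smul]; group

theorem inv_mul_mem_flowHom {u v : V} {h p : G} (hh : h ∈ flowHom ℓ u v)
    (hp : p ∈ flowHom ℓ u v) : p⁻¹ * h ∈ flowHom ℓ u u := by
  obtain ⟨i, j, hij, rfl⟩ := hh
  obtain ⟨a, b, hab, rfl⟩ := hp
  rcases le_total j b with hjb | hjb
  · obtain ⟨k, rfl⟩ := Nat.exists_eq_add_of_le hjb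
    refine ⟨i + k, a, ?_, ?_⟩
    · rw [hab, add_comm i, add_comm j, Function.iterate_add_apply, hij,
        ← Function.iterate_add_apply]
    · rw [flowLabel_add j, flowLabel_add i, hij]; group
  · obtain ⟨k, rfl⟩ := Nat.exists_eq_add_of_le hjb
    refine ⟨i, a + k, ?_, ?_⟩
    · rw [hij, add_comm a, add_comm b, Function.iterate_add_apply, ← hab,
        ← Function.iterate_add_apply]
    · rw [flowLabel_add b, flowLabel_add a, hab]; group

theorem exists_generator_flowHom (ℓ : V → G) (z : V) :
    ∃ c : G, c • z = z ∧ flowHom ℓ z z ⊆ Subgroup.zpowers c := by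
  classical
  set f : V → V := fun v => ℓ v • v with hf
  by_cases hper : ∃ b, ∃ a < b, f^[a] z = f^[b] z
  · obtain ⟨a, hab, hfab⟩ := Nat.find_spec hper
    have hmin : ∀ i j, i < Nat.find hper → j < Nat.find hper → f^[i] z = f^[j] z → i = j := by
      intro i j hi hj hij
      rcases lt_trichotomy i j with h | h | h
      · exact absurd ⟨i, h, hij⟩ (Nat.find_min hper hj)
      · exact h
      · exact absurd ⟨j, h, hij.symm⟩ (Nat.find_min hper hi)
    generalize Nat.find hper = b at *
    set c := (flowLabel ℓ a z)⁻¹ * flowLabel ℓ b z with hc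
    have hlab : ∀ k, flowLabel ℓ (b + k) z = flowLabel ℓ (a + k) z * c := by
      intro k
      rw [flowLabel_add, flowLabel_add, ← hf, hfab, hc]; group
    have hit : ∀ k, f^[b + k] z = f^[a + k] z := by
      intro k
      rw [add_comm b, add_comm a, Function.iterate_add_apply, Function.iterate_add_apply, hfab]
    have hcm : c ∈ flowHom ℓ z z := ⟨b, a, hfab.symm, hc⟩
    refine ⟨c, smul_eq_of_mem_flowHom hcm, ?_⟩
    have key : ∀ n i j, i + j = n → f^[i] z = f^[j] z →
        (flowLabel ℓ j z)⁻¹ * flowLabel ℓ i z ∈ Subgroup.zpowers c := by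
      intro n
      induction n using Nat.strong_induction_on with
      | _ n ih =>
      intro i j hn hij
      by_cases hi : i < b
      · by_cases hj : j < b
        · rw [hmin i j hi hj hij, inv_mul_cancel]; exact one_mem _
        · obtain ⟨k, rfl⟩ := Nat.exists_eq_add_of_le (not_lt.1 hj)
          rw [hlab, mul_inv_rev, mul_assoc]
          rw [hit] at hij
          exact mul_mem (inv_mem (Subgroup.mem_zpowers c)) (ih _ (by omega) i (a + k) rfl hij)
      · obtain ⟨k, rfl⟩ := Nat.exists_eq_add_of_le (not_lt.1 hi)
        rw [hlab, ← mul_assoc]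
        rw [hit] at hij
        exact mul_mem (ih _ (by omega) (a + k) j rfl hij) (Subgroup.mem_zpowers c)
    rintro _ ⟨i, j, hij, rfl⟩
    exact key _ i j rfl hij
  · refine ⟨1, one_smul _ _, ?_⟩
    rintro _ ⟨i, j, hij, rfl⟩
    have : i = j := by
      rcases lt_trichotomy i j with h | h | h
      · exact absurd ⟨j, i, h, hij⟩ hper
      · exact h
      · exact absurd ⟨i, j, h, hij.symm⟩ hper
    subst this
    rw [inv_mul_cancel]; exact one_mem _

/-- If all but finitely many edges of the Schreier graph lie on flow lines, then point
stabilizers are finitely generated. -/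
theorem fg_stabilizer_of_flow {S : Set G} (hSf : S.Finite) (hS : Submonoid.closure S = ⊤)
    (ℓ : V → G)
    (hbad : {p : V × G | p.2 ∈ S ∧ ℓ p.1 ≠ p.2 ∧ ℓ (p.2 • p.1) ≠ p.2⁻¹}.Finite) (v₀ : V) :
    (MulAction.stabilizer G v₀).FG := by
  classical
  set Bad := {p : V × G | p.2 ∈ S ∧ ℓ p.1 ≠ p.2 ∧ ℓ (p.2 • p.1) ≠ p.2⁻¹} with hBad
  let Z : Set V := {v₀} ∪ (Prod.fst '' Bad ∪ (fun p => p.2 • p.1) '' Bad)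
  have hZ : Z.Finite := (Set.finite_singleton _).union ((hbad.image _).union (hbad.image _))
  have hv₀ : v₀ ∈ Z := Or.inl rfl
  choose c hc hc' using exists_generator_flowHom ℓ
  let q : V → G := fun v => if h : ∃ g : G, g • v₀ = v then h.choose else 1
  have hq : ∀ v, (∃ g : G, g • v₀ = v) → q v • v₀ = v := by
    intro v h
    simp only [q, h, dite_true]
    exact h.choose_spec
  let p : V → V → G := fun u v => if h : (flowHom ℓ u v).Nonempty then h.choose else 1
  have hp : ∀ u v, (flowHom ℓ u v).Nonempty → p u v ∈ flowHom ℓ u v := by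
    intro u v h
    simp only [p, h, dite_true]
    exact h.choose_spec
  let T : Set G := {q v₀} ∪ ((fun z => (q z)⁻¹ * c z * q z) '' Z ∪
    ((fun x : V × V => (q x.2)⁻¹ * p x.1 x.2 * q x.1) '' Z ×ˢ Z ∪
      (fun x : V × G => (q (x.2 • x.1))⁻¹ * x.2 * q x.1) '' Z ×ˢ S))
  have hT : T.Finite := (Set.finite_singleton _).union ((hZ.image _).union
    (((hZ.prod hZ).image _).union ((hZ.prod hSf).image _)))
  let T' : Set G := T ∩ MulAction.stabilizer G v₀
  set K := Subgroup.closure T' with hK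
  have hstab : ∀ u v (b : G), (∃ g : G, g • v₀ = u) → b • u = v →
      (q v)⁻¹ * b * q u ∈ MulAction.stabilizer G v₀ := by
    rintro u v b ⟨g, hg⟩ hb
    rw [MulAction.mem_stabilizer_iff, mul_smul, mul_smul, hq u ⟨g, hg⟩, hb, inv_smul_eq_iff,
      hq v ⟨b * g, by rw [mul_smul, hg, hb]⟩]
  have hseg : ∀ z ∈ Z, ∀ v ∈ Z, (∃ g : G, g • v₀ = z) → ∀ h ∈ flowHom ℓ z v,
      (q v)⁻¹ * h * q z ∈ K := by
    intro z hz v hv hgz h hh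
    have hpm := hp z v ⟨h, hh⟩
    obtain ⟨k, hk⟩ := hc' z (inv_mul_mem_flowHom hh hpm)
    have e1 : (q v)⁻¹ * p z v * q z ∈ K := Subgroup.subset_closure
      ⟨Or.inr (Or.inr (Or.inl ⟨(z, v), ⟨hz, hv⟩, rfl⟩)),
        hstab _ _ _ hgz (smul_eq_of_mem_flowHom hpm)⟩
    have e2 : (q z)⁻¹ * c z * q z ∈ K := Subgroup.subset_closure
      ⟨Or.inr (Or.inl ⟨z, hz, rfl⟩), hstab _ _ _ hgz (hc z)⟩
    have e3 := mul_mem e1 (zpow_mem e2 k)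
    have e4 : ((q z)⁻¹ * c z * q z) ^ k = (q z)⁻¹ * c z ^ k * q z := by
      simpa using conj_zpow (a := (q z)⁻¹) (b := c z) (i := k)
    have e5 : c z ^ k = (p z v)⁻¹ * h := hk
    rw [e4, e5] at e3
    convert e3 using 1
    group
  have main : ∀ w : G, ∃ z ∈ Z, ∃ u : G, u • v₀ = z ∧ (q z)⁻¹ * u ∈ K ∧
      w * u⁻¹ ∈ flowHom ℓ z (w • v₀) := by
    intro w
    have hw : w ∈ Submonoid.closure S := by rw [hS]; trivial
    induction hw using Submonoid.closure_induction_left with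
    | one =>
      refine ⟨v₀, hv₀, 1, one_smul _ _, ?_, by simpa using one_mem_flowHom v₀⟩
      rw [mul_one]
      refine inv_mem (Subgroup.subset_closure ⟨Or.inl rfl, ?_⟩)
      exact hq v₀ ⟨1, one_smul _ _⟩
    | mul_left s hs w _ ih =>
      obtain ⟨z, hz, u, hu, huK, hh⟩ := ih
      by_cases h1 : ℓ (w • v₀) = s
      · refine ⟨z, hz, u, hu, huK, ?_⟩
        have := label_mul_mem_flowHom hh
        rwa [h1, ← mul_assoc, ← mul_smul] at this
      by_cases h2 : ℓ (s • w • v₀) = s⁻¹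
      · refine ⟨z, hz, u, hu, huK, ?_⟩
        have := mul_mem_flowHom_of_label hh h2
        rwa [← mul_assoc, ← mul_smul] at this
      have hb : (w • v₀, s) ∈ Bad := ⟨hs, h1, h2⟩
      have hv : w • v₀ ∈ Z := Or.inr (Or.inl ⟨_, hb, rfl⟩)
      have hsv : s • w • v₀ ∈ Z := Or.inr (Or.inr ⟨_, hb, rfl⟩)
      have e1 := hseg z hz _ hv ⟨u, hu⟩ _ hh
      have e2 : (q (s • w • v₀))⁻¹ * s * q (w • v₀) ∈ K := Subgroup.subset_closure
        ⟨Or.inr (Or.inr (Or.inr ⟨(w • v₀, s), ⟨hv, hs⟩, rfl⟩)), hstab _ _ _ ⟨w, rfl⟩ rfl⟩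
      refine ⟨s • w • v₀, hsv, s * w, mul_smul _ _ _, ?_, ?_⟩
      · convert mul_mem e2 (mul_mem e1 huK) using 1
        group
      · rw [mul_inv_cancel, mul_smul]
        exact one_mem_flowHom _
  refine ⟨(hT.subset (Set.inter_subset_left : T' ⊆ T)).toFinset, ?_⟩
  rw [Set.Finite.coe_toFinset]
  refine le_antisymm ((Subgroup.closure_le _).2 Set.inter_subset_right) fun w hw => ?_
  change w ∈ K
  obtain ⟨z, hz, u, hu, huK, hh⟩ := main w
  rw [MulAction.mem_stabilizer_iff.1 hw] at hh
  have e1 := hseg z hz _ hv₀ ⟨u, hu⟩ _ hh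
  have e0 : q v₀ ∈ K := Subgroup.subset_closure ⟨Or.inl rfl, hq v₀ ⟨1, one_smul _ _⟩⟩
  convert mul_mem e0 (mul_mem e1 huK) using 1
  group

/-- A group with the twisted conjugation action. -/
@[ext]
structure Twisted (φ : G →* G) where
  val : G

instance (φ : G →* G) : MulAction G (Twisted φ) where
  smul w v := ⟨w * v.val * (φ w)⁻¹⟩
  one_smul v := by
    change Twisted.mk (1 * v.val * (φ 1)⁻¹ : G) = v
    simp
  mul_smul w w' v := by
    change Twisted.mk (w * w' * v.val * (φ (w * w'))⁻¹ : G) =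
      ⟨w * (w' * v.val * (φ w')⁻¹) * (φ w)⁻¹⟩
    rw [map_mul, Twisted.mk.injEq]; group

end FlowStabilizer

namespace FreeGroup

variable {ι : Type*} [DecidableEq ι]

theorem mk_singleton_mul_mem_cone {x : ι × Bool} {g : FreeGroup ι}
    (h : g ∉ cone (x.1, !x.2)) : mk [x] * g ∈ cone x := by
  simp only [cone, Set.mem_ofPred_eq] at h ⊢
  rw [toWord_mul, toWord_mk, reduce_singleton, List.singleton_append, reduce.cons, reduce_toWord]
  rcases hg : g.toWord with _ | ⟨y, L⟩
  · simp
  · have : ¬ (x.1 = y.1 ∧ x.2 = !y.2) := by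
      rintro ⟨h1, h2⟩
      apply h
      rw [hg]
      simp [h1, h2]
    simp [this]

theorem closure_range_mk_singleton :
    Submonoid.closure (Set.range fun x : ι × Bool => mk [x]) = ⊤ := by
  rw [eq_top_iff]
  rintro g -
  rw [← mk_toWord (x := g)]
  induction g.toWord with
  | nil => exact one_mem _
  | cons x L ih =>
    rw [← List.singleton_append, ← mul_mk]
    exact mul_mem (Submonoid.subset_closure ⟨x, rfl⟩) ih

/-- **Goldstein–Turner**: fixed subgroups of endomorphisms of free groups of finite rank are
finitely generated. -/
theorem fg_eqLocus_id [Finite ι] (φ : FreeGroup ι →* FreeGroup ι) :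
    (φ.eqLocus (MonoidHom.id _)).FG := by
  have hstab : φ.eqLocus (MonoidHom.id _) =
      MulAction.stabilizer (FreeGroup ι) (⟨1⟩ : Twisted φ) := by
    ext w
    change φ w = w ↔ Twisted.mk (w * 1 * (φ w)⁻¹) = (⟨1⟩ : Twisted φ)
    rw [Twisted.mk.injEq, mul_one, mul_inv_eq_one, eq_comm]
  rw [hstab]
  let ℓ : Twisted φ → FreeGroup ι := fun g =>
    match g.val.toWord.head? with
    | none => 1
    | some x => (mk [x])⁻¹
  have hℓ : ∀ (g : Twisted φ) x, g.val ∈ cone x → ℓ g = (mk [x])⁻¹ := by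
    intro g x hx
    have hx : g.val.toWord.head? = some x := hx
    simp only [ℓ, hx]
  refine fg_stabilizer_of_flow (Set.finite_range _) closure_range_mk_singleton ℓ ?_ _
  have hfin : (⋃ x : ι × Bool, (fun y => ((⟨(mk [x])⁻¹ * y⟩ : Twisted φ), mk [x])) ''
      rightBd (cone x) (φ (mk [x]))⁻¹).Finite :=
    Set.finite_iUnion fun x => (finite_rightBd_cone x _).image _
  refine hfin.subset ?_
  rintro ⟨g, _⟩ ⟨⟨x, rfl⟩, h1, h2⟩
  refine Set.mem_iUnion.2 ⟨x, mk [x] * g.val, ?_, ?_⟩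
  · have h3 : g.val ∉ cone (x.1, !x.2) := by
      intro h
      apply h1
      rw [hℓ _ _ h, inv_mk]
      simp [invRev]
    have h4 : mk [x] * g.val * (φ (mk [x]))⁻¹ ∉ cone x := fun h => h2 (hℓ _ _ h)
    simp only [rightBd, Set.mem_ofPred_eq]
    have := mk_singleton_mul_mem_cone h3
    tauto
  · exact Prod.ext (Twisted.ext (inv_mul_cancel_left _ _)) rfl

end FreeGroup

theorem MonoidHom.exists_iterate {M : Type*} [MulOneClass M] (θ : M →* M) (n : ℕ) :
    ∃ ψ : M →* M, ∀ g, ψ g = (θ^[n]) g := by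
  induction n with
  | zero => exact ⟨MonoidHom.id M, fun _ => rfl⟩
  | succ n ih =>
    obtain ⟨ψ, hψ⟩ := ih
    exact ⟨ψ.comp θ, fun g => hψ (θ g)⟩

theorem FreeGroup.isFreeFactorOf_inf_eqLocus {ι : Type*} [Finite ι] [DecidableEq ι]
    (θ : FreeGroup ι →* FreeGroup ι) {N : ℕ} (hN : 0 < N) (K : Subgroup (FreeGroup ι))
    (hK : ∀ k ∈ K, (θ^[N]) k = k) :
    IsFreeFactorOf (K ⊓ θ.eqLocus (MonoidHom.id _)) K := by
  obtain ⟨θN, hθN⟩ : ∃ ψ : FreeGroup ι →* FreeGroup ι, ∀ g, ψ g = (θ^[N]) g :=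
    MonoidHom.exists_iterate θ N
  set Γ := θN.eqLocus (MonoidHom.id _) with hΓ
  have hmem : ∀ g, g ∈ Γ ↔ (θ^[N]) g = g := fun g => by rw [← hθN]; rfl
  have : Group.FG Γ := (Group.fg_iff_subgroup_fg Γ).2 (FreeGroup.fg_eqLocus_id θN)
  have hstable : ∀ g ∈ Γ, θ g ∈ Γ := by
    intro g hg
    rw [hmem] at hg ⊢
    rw [← Function.iterate_succ_apply, Function.iterate_succ_apply', hg]
  let a : Γ →* Γ := (θ.comp Γ.subtype).codRestrict Γ fun g => hstable g g.2
  have ha : ∀ (n : ℕ) (g : Γ), ((a^[n] g : Γ) : FreeGroup ι) = (θ^[n]) g := by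
    intro n
    induction n with
    | zero => intro g; rfl
    | succ n ih => intro g; rw [Function.iterate_succ_apply, ih, Function.iterate_succ_apply]; rfl
  have haN : ∀ g, (a^[N]) g = g := fun g => Subtype.ext (by rw [ha, (hmem _).1 g.2])
  have hbij : Function.Bijective a := by
    obtain ⟨M, rfl⟩ : ∃ M, N = M + 1 := ⟨N - 1, by omega⟩
    constructor
    · intro x y hxy
      rw [← haN x, ← haN y, Function.iterate_succ_apply, Function.iterate_succ_apply, hxy]
    · intro x
      exact ⟨(a^[M]) x, (Function.iterate_succ_apply' a M x).symm.trans (haN x)⟩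
  have := (isFreeFactorOf_inf_fixed (G := Γ)
    (fun g n hn h => Subtype.ext ((pow_eq_one_iff_left hn.ne').1 (congrArg Subtype.val h)))
    (FreeGroup.separatesPowers.subgroup Γ) (MulEquiv.ofBijective a hbij) hN haN
    (K.subgroupOf Γ)).map Γ.subtype Γ.subtype_injective
  have hKΓ : K ≤ Γ := fun k hk => (hmem k).2 (hK k hk)
  rw [Subgroup.map_subgroupOf_eq_of_le hKΓ] at this
  convert this using 1
  ext x
  simp only [Subgroup.mem_inf, Subgroup.mem_map]
  constructor
  · rintro ⟨hx, hx'⟩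
    exact ⟨⟨x, hKΓ hx⟩, ⟨hx, Subtype.ext hx'⟩, rfl⟩
  · rintro ⟨y, ⟨hy, hy'⟩, rfl⟩
    exact ⟨hy, congrArg Subtype.val hy'⟩

section Sanov

open Matrix

/-- The matrix `[[-c, cd+1], [-1, d]]`, with `c = 6 * i` and `d = 6 * i + 3`; as a Möbius
transformation it maps the exterior of the unit interval around `d` into the unit interval around `c`. -/
def pingPongMatrix (i : ℕ) : SpecialLinearGroup (Fin 2) ℤ :=
  ⟨!![-(6 * i), 6 * i * (6 * i + 3) + 1; -1, 6 * i + 3], by rw [det_fin_two_of]; ring⟩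

/-- The matrices whose first column `(u, v)` has slope `u / v` at distance at most one from `c`. -/
def slopeNear (c : ℤ) : Set (SpecialLinearGroup (Fin 2) ℤ) :=
  {M | |M 0 0 - c * M 1 0| ≤ |M 1 0|}

theorem slopeNear_nonempty (c : ℤ) : (slopeNear c).Nonempty :=
  ⟨⟨!![c, -1; 1, 0], by simp [det_fin_two_of]⟩, by
    change |c - c * 1| ≤ |(1 : ℤ)|
    simp⟩

theorem disjoint_slopeNear {c d : ℤ} (h : 3 ≤ |c - d|) :
    Disjoint (slopeNear c) (slopeNear d) := by
  rw [Set.disjoint_left]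
  intro M h1 h2
  have h1 : |M 0 0 - c * M 1 0| ≤ |M 1 0| := h1
  have h2 : |M 0 0 - d * M 1 0| ≤ |M 1 0| := h2
  have h3 : |c - d| * |M 1 0| ≤ 2 * |M 1 0| := by
    rw [← abs_mul, show (c - d) * M 1 0 = (M 0 0 - d * M 1 0) - (M 0 0 - c * M 1 0) by ring]
    exact (abs_sub _ _).trans (by linarith)
  have h4 : |M 1 0| = 0 := by nlinarith [abs_nonneg (M 1 0)]
  have h5 : M 1 0 = 0 := abs_eq_zero.1 h4
  rw [h4, h5, mul_zero, sub_zero] at h1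
  have h6 : M 0 0 = 0 := abs_eq_zero.1 (le_antisymm h1 (abs_nonneg _))
  have h7 := M.det_coe
  rw [det_fin_two, h5, h6] at h7
  simp at h7

theorem pingPongMatrix_mul_mem {i : ℕ} {M : SpecialLinearGroup (Fin 2) ℤ}
    (hM : M ∉ slopeNear (6 * i + 3)) : pingPongMatrix i * M ∈ slopeNear (6 * i) := by
  have hM : ¬ |M 0 0 - (6 * i + 3) * M 1 0| ≤ |M 1 0| := hM
  have h0 : (pingPongMatrix i * M) 0 0 =
      -(6 * i) * M 0 0 + (6 * i * (6 * i + 3) + 1) * M 1 0 :=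
    (mul_apply ..).trans (Fin.sum_univ_two _)
  have h1 : (pingPongMatrix i * M) 1 0 = -1 * M 0 0 + (6 * i + 3) * M 1 0 :=
    (mul_apply ..).trans (Fin.sum_univ_two _)
  change |(pingPongMatrix i * M) 0 0 - _ * (pingPongMatrix i * M) 1 0| ≤
    |(pingPongMatrix i * M) 1 0|
  rw [h0, h1]
  rw [← abs_neg (-1 * M 0 0 + _)]
  ring_nf at hM ⊢
  exact (not_le.1 hM).le

theorem pingPongMatrix_inv_mul_mem {i : ℕ} {M : SpecialLinearGroup (Fin 2) ℤ}
    (hM : M ∉ slopeNear (6 * i)) : (pingPongMatrix i)⁻¹ * M ∈ slopeNear (6 * i + 3) := by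
  have hM : ¬ |M 0 0 - (6 * i) * M 1 0| ≤ |M 1 0| := hM
  have hinv : (pingPongMatrix i)⁻¹.1 =
      (!![6 * i + 3, -(6 * i * (6 * i + 3) + 1); -(-1), -(6 * i)] : Matrix _ _ ℤ) :=
    adjugate_fin_two_of _ _ _ _
  have h0 : ((pingPongMatrix i)⁻¹ * M) 0 0 =
      (6 * i + 3) * M 0 0 + -(6 * i * (6 * i + 3) + 1) * M 1 0 :=
    (mul_apply ..).trans ((Fin.sum_univ_two _).trans (by rw [hinv]; rfl))
  have h1 : ((pingPongMatrix i)⁻¹ * M) 1 0 = -(-1) * M 0 0 + -(6 * i) * M 1 0 :=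
    (mul_apply ..).trans ((Fin.sum_univ_two _).trans (by rw [hinv]; rfl))
  change |((pingPongMatrix i)⁻¹ * M) 0 0 - _ * ((pingPongMatrix i)⁻¹ * M) 1 0| ≤
    |((pingPongMatrix i)⁻¹ * M) 1 0|
  rw [h0, h1]
  rw [← abs_neg]
  ring_nf at hM ⊢
  exact (not_le.1 hM).le

theorem FreeGroup.injective_lift_pingPongMatrix :
    Function.Injective (FreeGroup.lift pingPongMatrix) := by
  refine FreeGroup.injective_lift_of_ping_pong pingPongMatrix (fun i => slopeNear (6 * i))
    (fun i => slopeNear (6 * i + 3)) (fun i => slopeNear_nonempty _) ?_ ?_ ?_ ?_ ?_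
  · intro i j hij
    refine disjoint_slopeNear ?_
    rw [le_abs]
    omega
  · intro i j hij
    refine disjoint_slopeNear ?_
    rw [le_abs]
    omega
  · intro i j
    refine disjoint_slopeNear ?_
    rw [le_abs]
    omega
  · rintro i _ ⟨M, hM, rfl⟩
    exact pingPongMatrix_mul_mem hM
  · rintro i _ ⟨M, hM, rfl⟩
    exact pingPongMatrix_inv_mul_mem hM

theorem FreeGroup.exists_injective_specialLinearGroup (ι : Type*) [Countable ι] :
    ∃ ρ : FreeGroup ι →* SpecialLinearGroup (Fin 2) ℤ, Function.Injective ρ := by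
  obtain ⟨f, hf⟩ := exists_injective_nat ι
  exact ⟨(FreeGroup.lift pingPongMatrix).comp (FreeGroup.map f),
    FreeGroup.injective_lift_pingPongMatrix.comp (FreeGroup.map_injective hf)⟩

end Sanov

section EquationallyNoetherian

open Matrix

variable {G : Type*} [Group G]

theorem exists_finite_determining {n : ℕ} {R H : Type*} [CommRing R] [IsNoetherianRing R]
    [Group H] (ρ : H →* SpecialLinearGroup (Fin n) R) (hρ : Function.Injective ρ)
    [Group.FG G] (K : Set G) :
    ∃ B ⊆ K, B.Finite ∧ ∀ θ θ' : G →* H, (∀ b ∈ B, θ b = θ' b) → ∀ k ∈ K, θ k = θ' k := by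
  classical
  obtain ⟨T, hT⟩ := Group.fg_def.1 ‹Group.FG G›
  let E : Bool → G → Fin n → Fin n → ((Bool → (G →* H)) → R) := fun s g k l p => ρ (p s g) k l
  let gens : Set ((Bool → (G →* H)) → R) :=
    ⋃ s : Bool, ⋃ g ∈ (T ∪ T.image (·⁻¹) : Finset G), ⋃ k, ⋃ l, {E s g k l}
  have hgens : gens.Finite := by
    refine Set.finite_iUnion fun s => (Finset.finite_toSet _).biUnion fun g _ =>
      Set.finite_iUnion fun k => Set.finite_iUnion fun l => Set.finite_singleton _
  let Z := Algebra.adjoin R gens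
  have : IsNoetherianRing Z := by
    have hfg : Z.FG := ⟨hgens.toFinset, by simp [Z]⟩
    have := Z.fg_iff_finiteType.1 hfg
    exact Algebra.FiniteType.isNoetherianRing R Z
  have hE : ∀ s g k l, E s g k l ∈ Z := by
    intro s g
    have hg : g ∈ Subgroup.closure (T : Set G) := hT ▸ Subgroup.mem_top g
    rw [← Subgroup.mem_toSubmonoid, Subgroup.closure_toSubmonoid] at hg
    induction hg using Submonoid.closure_induction with
    | mem x hx =>
      intro k l
      refine Algebra.subset_adjoin ?_
      simp only [gens, Set.mem_iUnion]
      exact ⟨s, x, by simpa [inv_eq_iff_eq_inv] using hx, k, l, rfl⟩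
    | one =>
      intro k l
      have : E s 1 k l = algebraMap R _ ((1 : Matrix (Fin n) (Fin n) R) k l) := by
        ext p
        simp [E]
      rw [this]
      exact Z.algebraMap_mem _
    | mul x y _ _ hx hy =>
      intro k l
      have : E s (x * y) k l = ∑ m, E s x k m * E s y m l := by
        ext p
        simp [E, Matrix.mul_apply]
      rw [this]
      exact Z.sum_mem fun m _ => Z.mul_mem (hx k m) (hy m l)
  let D : G → Fin n → Fin n → Z := fun g k l =>
    ⟨E true g k l, hE _ _ _ _⟩ - ⟨E false g k l, hE _ _ _ _⟩
  let I : Ideal Z := Ideal.span {d | ∃ g ∈ K, ∃ k l, D g k l = d}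
  obtain ⟨S, hS, hSI⟩ := (Submodule.fg_span_iff_fg_span_finset_subset _).1
    (IsNoetherian.noetherian I)
  choose! b hbK hb using fun d (hd : d ∈ S) => hS hd
  refine ⟨b '' S, ?_, S.finite_toSet.image _, ?_⟩
  · rintro _ ⟨d, hd, rfl⟩
    exact hbK d hd
  · intro θ θ' h g hg
    let p : Bool → (G →* H) := fun s => if s then θ else θ'
    let ev : Z →+* R := (Pi.evalRingHom (fun _ => R) p).comp Z.val.toRingHom
    have hev : ∀ g k l, ev (D g k l) = ρ (θ g) k l - ρ (θ' g) k l := fun g k l => rfl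
    have hker : I ≤ RingHom.ker ev := by
      change Submodule.span _ _ ≤ _
      rw [hSI, Submodule.span_le]
      intro d hd
      obtain ⟨k, l, hkl⟩ := hb d hd
      change ev d = 0
      rw [← hkl, hev, h _ ⟨d, hd, rfl⟩, sub_self]
    refine hρ (Subtype.ext <| Matrix.ext fun k l => sub_eq_zero.1 ?_)
    rw [← hev]
    exact hker (Ideal.subset_span ⟨g, hg, k, l, rfl⟩)

end EquationallyNoetherian

/-- Free groups are equationally Noetherian: on any subset, homomorphisms from a finitely generated
group to a free group are determined by their values on some finite subset. -/
theorem FreeGroup.exists_finite_determining {G ι : Type*} [Group G] [Group.FG G] [Countable ι]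
    (K : Set G) :
    ∃ B ⊆ K, B.Finite ∧
      ∀ θ θ' : G →* FreeGroup ι, (∀ b ∈ B, θ b = θ' b) → ∀ k ∈ K, θ k = θ' k := by
  obtain ⟨ρ, hρ⟩ := FreeGroup.exists_injective_specialLinearGroup ι
  exact _root_.exists_finite_determining ρ hρ K

section FreeOfFiniteRank

variable {F : Type*} [Group F]

theorem IsFreeOfFiniteRank.isFreeFactorOf_inf_eqLocus (hF : IsFreeOfFiniteRank F) (θ : F →* F)
    {N : ℕ} (hN : 0 < N) (K : Subgroup F) (hK : ∀ k ∈ K, (θ^[N]) k = k) :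
    IsFreeFactorOf (K ⊓ θ.eqLocus (MonoidHom.id _)) K := by
  classical
  obtain ⟨n, ⟨e⟩⟩ := hF
  let η : FreeGroup (Fin n) →* FreeGroup (Fin n) :=
    e.toMonoidHom.comp (θ.comp e.symm.toMonoidHom)
  have hη : ∀ m g, (η^[m]) (e g) = e ((θ^[m]) g) := by
    intro m
    induction m with
    | zero => intro g; rfl
    | succ m ih =>
      intro g
      rw [Function.iterate_succ_apply, Function.iterate_succ_apply, ← ih]
      simp [η]
  have := (FreeGroup.isFreeFactorOf_inf_eqLocus η hN (K.map e.toMonoidHom) (by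
    rintro _ ⟨k, hk, rfl⟩
    exact (hη N k).trans (congrArg e (hK k hk)))).map e.symm.toMonoidHom e.symm.injective
  convert this using 1
  · ext x
    constructor
    · rintro ⟨h1, h2⟩
      exact ⟨e x, ⟨⟨x, h1, rfl⟩, (hη 1 x).trans (congrArg e h2)⟩, e.symm_apply_apply x⟩
    · rintro ⟨_, ⟨⟨y, h1, rfl⟩, h2⟩, rfl⟩
      have h3 : e.symm (e y) = y := e.symm_apply_apply y
      change e.symm (e y) ∈ _
      rw [h3]
      exact ⟨h1, e.injective ((hη 1 y).symm.trans h2)⟩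
  · ext x
    simp

theorem IsFreeOfFiniteRank.exists_finite_determining (hF : IsFreeOfFiniteRank F) (K : Set F) :
    ∃ B ⊆ K, B.Finite ∧
      ∀ θ θ' : F →* F, (∀ b ∈ B, θ b = θ' b) → ∀ k ∈ Subgroup.closure K, θ k = θ' k := by
  obtain ⟨n, ⟨e⟩⟩ := hF
  have : Group.FG F := Group.fg_of_surjective (f := e.symm.toMonoidHom) e.symm.surjective
  obtain ⟨B, hBK, hB, h⟩ := FreeGroup.exists_finite_determining (ι := Fin n) K
  refine ⟨B, hBK, hB, fun θ θ' hθ k hk => ?_⟩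
  refine MonoidHom.eqOn_closure (f := θ) (g := θ') (fun k hk => e.injective ?_) hk
  exact h (e.toMonoidHom.comp θ) (e.toMonoidHom.comp θ') (fun b hb => congrArg e (hθ b hb)) k hk

theorem exists_iterate_eq_of_mapsTo_injOn {α : Type*} {Q : Set (Set α)} (hQ : (⋃₀ Q).Finite)
    {f : α → α} (hf : ∀ S ∈ Q, Set.MapsTo f S S ∧ Set.InjOn f S) :
    ∃ N, 0 < N ∧ ∀ x ∈ ⋃₀ Q, (f^[N]) x = x := by
  have hmaps : Set.MapsTo f (⋃₀ Q) (⋃₀ Q) := by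
    rintro x ⟨S, hS, hx⟩
    exact ⟨S, hS, (hf S hS).1 hx⟩
  have : Finite ↥(⋃₀ Q) := hQ
  have hsurj : Function.Surjective (hmaps.restrict f _ _) := by
    rintro ⟨x, S, hS, hx⟩
    have : Finite S := hQ.subset (Set.subset_sUnion_of_mem hS)
    obtain ⟨⟨y, hy⟩, h⟩ := Finite.injective_iff_surjective.1
      ((hf S hS).1.restrict_inj.2 (hf S hS).2) ⟨x, hx⟩
    exact ⟨⟨y, S, hS, hy⟩, Subtype.ext (congrArg Subtype.val h :)⟩
  let p : Equiv.Perm ↥(⋃₀ Q) := Equiv.ofBijective _ (Finite.injective_iff_bijective.1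
    (Finite.injective_iff_surjective.2 hsurj))
  refine ⟨orderOf p, orderOf_pos p, fun x hx => ?_⟩
  have h1 : ∀ (m : ℕ) (x : ↥(⋃₀ Q)), ((p ^ m) x : α) = (f^[m]) x := by
    intro m
    induction m with
    | zero => intro x; rfl
    | succ m ih =>
      intro x
      rw [pow_succ, Equiv.Perm.mul_apply, ih, Function.iterate_succ_apply]
      rfl
  rw [← h1 _ ⟨x, hx⟩, pow_orderOf_eq_one]
  rfl

theorem IsFreeOfFiniteRank.isFreeFactorOf_of_definable (hF : IsFreeOfFiniteRank F)
    (𝒟 : Set (Set F))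
    (h𝒟 : ∀ (P : Set (F × Set F)) (U : Set F) (w : F), P.Finite → U.Finite →
      (∀ p ∈ P, p.2 ∈ 𝒟) →
      {x | ∃ θ : F →* F, (∀ p ∈ P, θ p.1 ∈ p.2) ∧ (∀ u ∈ U, θ u ≠ 1) ∧ θ w = x} ∈ 𝒟) :
    IsFreeFactorOf (Subgroup.closure {b | {b} ∈ 𝒟})
      (Subgroup.closure {b | ∃ D ∈ 𝒟, D.Finite ∧ b ∈ D}) := by
  set K := Subgroup.closure {b | ∃ D ∈ 𝒟, D.Finite ∧ b ∈ D} with hK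
  obtain ⟨B, hBK, hB, hdetB⟩ := hF.exists_finite_determining {b | ∃ D ∈ 𝒟, D.Finite ∧ b ∈ D}
  obtain ⟨C, hCK, hC, hdetC⟩ := hF.exists_finite_determining {b | {b} ∈ 𝒟}
  choose! D hD𝒟 hDfin hbD using fun b (hb : b ∈ B) => hBK hb
  let Q : Set (Set F) := D '' B ∪ (fun c => {c}) '' C
  have hQfin : Q.Finite := (hB.image _).union (hC.image _)
  have hQ : ∀ S ∈ Q, S ∈ 𝒟 ∧ S.Finite := by
    rintro _ (⟨b, hb, rfl⟩ | ⟨c, hc, rfl⟩)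
    · exact ⟨hD𝒟 b hb, hDfin b hb⟩
    · exact ⟨hCK hc, Set.finite_singleton c⟩
  have hX : (⋃₀ Q).Finite := hQfin.sUnion fun S hS => (hQ S hS).2
  have hBX : B ⊆ ⋃₀ Q := fun b hb => ⟨D b, Or.inl ⟨b, hb, rfl⟩, hbD b hb⟩
  let 𝒯 : Set (F →* F) := {θ | ∀ S ∈ Q, Set.MapsTo θ S S ∧ Set.InjOn θ S}
  have hdcl : ∀ k, k ∈ Subgroup.closure {b | {b} ∈ 𝒟} ↔ k ∈ K ∧ ∀ θ ∈ 𝒯, θ k = k := by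
    intro k
    constructor
    · intro hk
      refine ⟨Subgroup.closure_mono ?_ hk, fun θ hθ => ?_⟩
      · intro b hb
        exact ⟨{b}, hb, Set.finite_singleton b, rfl⟩
      · refine hdetC θ (MonoidHom.id F) (fun c hc => ?_) k hk
        exact (hθ {c} (Or.inr ⟨c, hc, rfl⟩)).1 rfl
    · rintro ⟨-, hk⟩
      refine Subgroup.subset_closure ?_
      let P : Set (F × Set F) := ⋃ S ∈ Q, (fun c => (c, S)) '' S
      let U : Set F := ⋃ S ∈ Q, (fun p : F × F => p.1⁻¹ * p.2) '' S.offDiag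
      have hP : P.Finite := hQfin.biUnion fun S hS => (hQ S hS).2.image _
      have hU : U.Finite := hQfin.biUnion fun S hS => (hQ S hS).2.offDiag.image _
      have h1 := h𝒟 P U k hP hU (by
        intro p hp
        simp only [P, Set.mem_iUnion] at hp
        obtain ⟨S, hS, c, hc, rfl⟩ := hp
        exact (hQ S hS).1)
      change {k} ∈ 𝒟
      convert h1
      ext x
      constructor
      · rintro rfl
        refine ⟨MonoidHom.id F, ?_, ?_, rfl⟩
        · intro p hp
          simp only [P, Set.mem_iUnion] at hp
          obtain ⟨S, hS, c, hc, rfl⟩ := hp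
          exact hc
        · intro u hu
          simp only [U, Set.mem_iUnion] at hu
          obtain ⟨S, hS, ⟨c, c'⟩, hc, rfl⟩ := hu
          exact fun h => hc.2.2 (inv_mul_eq_one.1 h)
      · rintro ⟨θ, hθP, hθU, rfl⟩
        refine hk θ fun S hS => ⟨fun c hc => ?_, fun c hc c' hc' h => ?_⟩
        · refine hθP (c, S) ?_
          simp only [P, Set.mem_iUnion]
          exact ⟨S, hS, c, hc, rfl⟩
        · by_contra hne
          refine hθU (c⁻¹ * c') ?_ (by rw [map_mul, map_inv, h, inv_mul_cancel])
          simp only [U, Set.mem_iUnion]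
          exact ⟨S, hS, (c, c'), ⟨hc, hc', hne⟩, rfl⟩
  have hstep : ∀ θ ∈ 𝒯, ∀ K' ≤ K, IsFreeFactorOf (K' ⊓ θ.eqLocus (MonoidHom.id F)) K' := by
    intro θ hθ K' hK'
    obtain ⟨N, hN, hNX⟩ := exists_iterate_eq_of_mapsTo_injOn hX hθ
    obtain ⟨ψ, hψ⟩ := MonoidHom.exists_iterate θ N
    refine hF.isFreeFactorOf_inf_eqLocus θ hN K' fun k hk => ?_
    rw [← hψ]
    exact hdetB ψ (MonoidHom.id F) (fun b hb => (hψ b).trans (hNX b (hBX hb))) k (hK' hk)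
  have hfinset : ∀ T : Finset (F →* F), (∀ θ ∈ T, θ ∈ 𝒯) →
      IsFreeFactorOf (K ⊓ ⨅ θ ∈ T, θ.eqLocus (MonoidHom.id F)) K := by
    classical
    intro T
    induction T using Finset.induction_on with
    | empty => intro _; simpa using IsFreeFactorOf.refl K
    | insert θ T _ ih =>
      intro hT
      rw [Finset.iInf_insert, inf_comm (θ.eqLocus _), ← inf_assoc]
      exact (hstep θ (hT θ (Finset.mem_insert_self _ _)) _ inf_le_left).trans
        (ih fun η hη => hT η (Finset.mem_insert_of_mem hη))
  have : Finite ↥(⋃₀ Q) := hX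
  let r : (F →* F) → (↥(⋃₀ Q) → F) := fun θ x => θ x
  have hr : (r '' 𝒯).Finite := by
    refine (Set.Finite.pi' fun _ : ↥(⋃₀ Q) => hX).subset ?_
    rintro _ ⟨θ, hθ, rfl⟩ ⟨x, S, hS, hx⟩
    exact ⟨S, hS, (hθ S hS).1 hx⟩
  obtain ⟨T, hT𝒯, hTfin, hT⟩ := Set.exists_subset_image_finite_and.1
    ⟨r '' 𝒯, subset_rfl, hr, rfl⟩
  convert hfinset hTfin.toFinset fun θ hθ => hT𝒯 (hTfin.mem_toFinset.1 hθ) using 1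
  ext k
  simp only [Subgroup.mem_inf, Subgroup.mem_iInf, hTfin.mem_toFinset]
  rw [hdcl]
  refine and_congr_right fun hk => ⟨fun h θ hθ => h θ (hT𝒯 hθ), fun h θ hθ => ?_⟩
  obtain ⟨η, hη, hηθ⟩ : r θ ∈ r '' T := hT ▸ ⟨θ, hθ, rfl⟩
  rw [← hdetB η θ (fun b hb => congrFun hηθ ⟨b, hBX hb⟩) k hk]
  exact h η hη

end FreeOfFiniteRank

section QuantifierFree

open FirstOrder.Language FirstOrder.Language.BoundedFormula

variable {L : FirstOrder.Language} {α β : Type*} {n : ℕ}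

theorem isQF_subst {φ : L.BoundedFormula α n} (hφ : φ.IsQF) (f : α → L.Term β) :
    (φ.subst f).IsQF := by
  induction hφ with
  | falsum => exact IsQF.falsum
  | of_isAtomic h =>
    cases h with
    | equal t₁ t₂ => exact (IsAtomic.equal _ _).isQF
    | rel R ts => exact (IsAtomic.rel _ _).isQF
  | imp _ _ h₁ h₂ => exact h₁.imp h₂

theorem isQF_toFormula {φ : L.BoundedFormula α n} (hφ : φ.IsQF) : φ.toFormula.IsQF := by
  induction hφ with
  | falsum => exact IsQF.falsum
  | of_isAtomic h =>
    cases h with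
    | equal t₁ t₂ => exact (IsAtomic.equal _ _).isQF
    | rel R ts => exact (IsAtomic.rel _ _).isQF
  | imp _ _ h₁ h₂ => exact h₁.imp h₂

theorem isExistential_iExs [Finite β] {φ : L.Formula (α ⊕ β)} (hφ : φ.IsQF) :
    _root_.IsExistential (φ.iExs β) :=
  ⟨_, _, hφ.relabel _, rfl⟩

end QuantifierFree

section GroupTerms

open FirstOrder.Language

theorem exists_term_realize_eq_lift {F : Type*} [Group F] {ι : Type*} (w : FreeGroup ι) :
    ∃ t : grpLang.Term ι, ∀ y : ι → F, t.realize y = FreeGroup.lift y w := by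
  induction w using FreeGroup.induction_on with
  | C1 => exact ⟨Term.func GrpFunc.one ![], fun y => (map_one _).symm⟩
  | of i => exact ⟨Term.var i, fun y => by simp⟩
  | inv_of i _ => exact ⟨Term.func GrpFunc.inv ![Term.var i], fun y => by simp; rfl⟩
  | mul v w hv hw =>
    obtain ⟨t, ht⟩ := hv
    obtain ⟨s, hs⟩ := hw
    refine ⟨Term.func GrpFunc.mul ![t, s], fun y => ?_⟩
    rw [map_mul, ← ht, ← hs]
    rfl

end GroupTerms

universe u

section ProjDefinable

open FirstOrder.Language FirstOrder.Language.BoundedFormula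

variable {F : Type u} [Group F]

/-- Classes of formulas containing the quantifier-free ones and closed under conjunction and
substitution. -/
structure IsFormulaClass (Ψ : ∀ α : Type u, grpLang.Formula α → Prop) : Prop where
  qf : ∀ {α : Type u} {φ : grpLang.Formula α}, φ.IsQF → Ψ α φ
  inf : ∀ {α : Type u} {φ ψ : grpLang.Formula α}, Ψ α φ → Ψ α ψ → Ψ α (φ ⊓ ψ)
  subst : ∀ {α β : Type u} {φ : grpLang.Formula α} (f : α → grpLang.Term β),
    Ψ α φ → Ψ β (φ.subst f)

/-- The projections to the line of the subsets of powers of `F` which are defined by formulas in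
the class `Ψ` with parameters in `A`. -/
def ProjDefinable (Ψ : ∀ α : Type u, grpLang.Formula α → Prop) (A : Set F) : Set (Set F) :=
  {D | ∃ (k : ℕ) (φ : grpLang.Formula ((A ⊕ Fin 1) ⊕ Fin k)), Ψ _ φ ∧
    D = {x | ∃ z, φ.Realize (Sum.elim (Sum.elim Subtype.val fun _ => x) z)}}

variable {Ψ : ∀ α : Type u, grpLang.Formula α → Prop}

theorem IsFormulaClass.exists_realize_iff_forall (hΨ : IsFormulaClass Ψ) {α ι : Type u} [Finite ι]
    (φ : ι → grpLang.Formula α) (hφ : ∀ i, Ψ α (φ i)) :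
    ∃ ψ, Ψ α ψ ∧ ∀ v : α → F, ψ.Realize v ↔ ∀ i, (φ i).Realize v := by
  classical
  have := Fintype.ofFinite ι
  suffices h : ∀ s : Finset ι,
      ∃ ψ, Ψ α ψ ∧ ∀ v : α → F, ψ.Realize v ↔ ∀ i ∈ s, (φ i).Realize v by
    simpa using h Finset.univ
  intro s
  induction s using Finset.induction_on with
  | empty => exact ⟨⊤, hΨ.qf IsQF.top, by simp⟩
  | insert i s _ ih =>
    obtain ⟨ψ, hψ, h⟩ := ih
    exact ⟨φ i ⊓ ψ, hΨ.inf (hφ i) hψ, fun v => by simp [h]⟩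

theorem IsFormulaClass.mem_projDefinable (hΨ : IsFormulaClass Ψ) {A : Set F} {κ : Type u}
    [Finite κ] {φ : grpLang.Formula ((A ⊕ Fin 1) ⊕ κ)} (hφ : Ψ _ φ) :
    {x | ∃ z, φ.Realize (Sum.elim (Sum.elim Subtype.val fun _ => x) z)} ∈ ProjDefinable Ψ A := by
  obtain ⟨k, ⟨e⟩⟩ := Finite.exists_equiv_fin κ
  refine ⟨k, φ.subst fun v => Term.var (Sum.map id e v), hΨ.subst _ hφ, ?_⟩
  ext x
  simp only [Set.mem_ofPred_eq, Formula.Realize, realize_subst, Term.realize_var]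
  rw [← (e.arrowCongr (Equiv.refl F)).exists_congr_right]
  refine exists_congr fun z => ?_
  rw [iff_iff_eq]
  congr
  funext v
  rcases v with v | v
  · rfl
  · simp

theorem IsFormulaClass.projDefinable_of_hom (hΨ : IsFormulaClass Ψ) (hF : IsFreeOfFiniteRank F)
    {A : Set F} (P : Set (F × Set F)) (U : Set F) (w : F) (hP : P.Finite) (hU : U.Finite)
    (h𝒟 : ∀ p ∈ P, p.2 ∈ ProjDefinable Ψ A) :
    {x | ∃ θ : F →* F, (∀ p ∈ P, θ p.1 ∈ p.2) ∧ (∀ u ∈ U, θ u ≠ 1) ∧ θ w = x} ∈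
      ProjDefinable Ψ A := by
  obtain ⟨n, ⟨e⟩⟩ := hF
  have : Finite P := hP
  have : Finite U := hU
  choose k φ hφ hD using fun p : P => h𝒟 p p.2
  let κ := ULift.{u} (Fin n) ⊕ Σ p : P, Fin (k p)
  let y : Fin n → (A ⊕ Fin 1) ⊕ κ := fun i => Sum.inr (Sum.inl ⟨i⟩)
  choose t ht using fun g : F => exists_term_realize_eq_lift (F := F) (e g)
  let χ : P → grpLang.Formula ((A ⊕ Fin 1) ⊕ κ) := fun p => (φ p).subst
    (Sum.elim (Sum.elim (fun a => Term.var (Sum.inl (Sum.inl a))) fun _ => (t p.1.1).relabel y)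
      fun i => Term.var (Sum.inr (Sum.inr ⟨p, i⟩)))
  let ν : U → grpLang.Formula ((A ⊕ Fin 1) ⊕ κ) := fun u =>
    Formula.not (((t u).relabel y).equal ((t 1).relabel y))
  let ε : grpLang.Formula ((A ⊕ Fin 1) ⊕ κ) :=
    ((t w).relabel y).equal (Term.var (Sum.inl (Sum.inr 0)))
  obtain ⟨χ', hχ', hχ⟩ := hΨ.exists_realize_iff_forall (F := F) χ fun p => hΨ.subst _ (hφ p)
  obtain ⟨ν', hν', hν⟩ := hΨ.exists_realize_iff_forall (F := F) ν fun u =>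
    hΨ.qf (IsAtomic.equal _ _).isQF.not
  convert hΨ.mem_projDefinable (hΨ.inf (hΨ.inf hχ' hν')
    (hΨ.qf (φ := ε) (IsAtomic.equal _ _).isQF)) using 1
  ext x
  simp only [Set.mem_ofPred_eq, Formula.realize_inf, hχ, hν, Subtype.forall]
  have hterm : ∀ g (z : κ → F), ((t g).relabel y).realize
      (Sum.elim (Sum.elim (Subtype.val : A → F) fun _ => x) z) =
      FreeGroup.lift (fun i => z (Sum.inl ⟨i⟩)) (e g) := by
    intro g z
    rw [Term.realize_relabel, ht]
    rfl
  have hχz : ∀ (p : P) (z : κ → F),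
      (χ p).Realize (Sum.elim (Sum.elim (Subtype.val : A → F) fun _ => x) z) ↔
      (φ p).Realize (Sum.elim (Sum.elim Subtype.val
        fun _ => FreeGroup.lift (fun i => z (Sum.inl ⟨i⟩)) (e p.1.1))
        fun i => z (Sum.inr ⟨p, i⟩)) := by
    intro p z
    simp only [χ, Formula.Realize, realize_subst]
    rw [iff_iff_eq]
    congr
    funext v
    rcases v with (v | v) | v
    · rfl
    · exact hterm _ z
    · rfl
  have hνz : ∀ (u : U) (z : κ → F),
      (ν u).Realize (Sum.elim (Sum.elim (Subtype.val : A → F) fun _ => x) z) ↔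
      FreeGroup.lift (fun i => z (Sum.inl ⟨i⟩)) (e u) ≠ 1 := by
    intro u z
    simp only [ν, Formula.realize_not, Formula.realize_equal, hterm, map_one, ne_eq]
  have hεz : ∀ (z : κ → F),
      ε.Realize (Sum.elim (Sum.elim (Subtype.val : A → F) fun _ => x) z) ↔
      FreeGroup.lift (fun i => z (Sum.inl ⟨i⟩)) (e w) = x := by
    intro z
    simp only [ε, Formula.realize_equal, hterm]
    rfl
  simp only [hχz, hνz, hεz]
  constructor
  · rintro ⟨θ, hθP, hθU, hθ⟩
    have hlift : ∀ g, FreeGroup.lift (fun i => θ (e.symm (FreeGroup.of i))) (e g) = θ g := by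
      intro g
      have : FreeGroup.lift (fun i => θ (e.symm (FreeGroup.of i))) =
          θ.comp e.symm.toMonoidHom := by
        ext i
        simp
      rw [this]
      simp
    have hz : ∀ p : P, ∃ z, (φ p).Realize (Sum.elim (Sum.elim Subtype.val fun _ => θ p.1.1) z) :=
      fun p => by
        have := hθP p p.2
        rw [hD p] at this
        exact this
    choose z hz using hz
    refine ⟨Sum.elim (fun i => θ (e.symm (FreeGroup.of i.down))) fun s => z s.1 s.2,
      ⟨fun p hp => ?_, fun u hu => ?_⟩, ?_⟩
    · simp only [Sum.elim_inl, Sum.elim_inr, hlift]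
      exact hz ⟨p, hp⟩
    · simp only [Sum.elim_inl, hlift]
      exact hθU u hu
    · simp only [Sum.elim_inl, hlift]
      exact hθ
  · rintro ⟨z, ⟨hzP, hzU⟩, hz⟩
    refine ⟨(FreeGroup.lift fun i => z (Sum.inl ⟨i⟩)).comp e.toMonoidHom,
      fun p hp => ?_, hzU, hz⟩
    rw [hD ⟨p, hp⟩]
    exact ⟨_, hzP p hp⟩

theorem IsFormulaClass.isFreeFactorOf (hΨ : IsFormulaClass Ψ) (hF : IsFreeOfFiniteRank F)
    (A : Set F) :
    IsFreeFactorOf (Subgroup.closure {b | {b} ∈ ProjDefinable Ψ A})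
      (Subgroup.closure {b | ∃ D ∈ ProjDefinable Ψ A, D.Finite ∧ b ∈ D}) :=
  hF.isFreeFactorOf_of_definable _ fun P U w hP hU h => hΨ.projDefinable_of_hom hF P U w hP hU h

theorem isFormulaClass_true : IsFormulaClass fun (α : Type u) (_ : grpLang.Formula α) => True :=
  ⟨fun _ => trivial, fun _ _ => trivial, fun _ _ => trivial⟩

theorem isFormulaClass_isQF :
    IsFormulaClass fun (α : Type u) (φ : grpLang.Formula α) => φ.IsQF :=
  ⟨id, IsQF.inf, fun f h => isQF_subst h f⟩

theorem mem_projDefinable_true_iff {A D : Set F} :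
    D ∈ ProjDefinable (fun _ _ => True) A ↔ ∃ φ : grpLang.Formula (A ⊕ Fin 1),
      D = {c | φ.Realize (Sum.elim Subtype.val fun _ => c)} := by
  constructor
  · rintro ⟨k, φ, -, rfl⟩
    exact ⟨φ.iExs (Fin k), by simp only [Formula.realize_iExs]⟩
  · rintro ⟨φ, rfl⟩
    refine ⟨0, φ.relabel Sum.inl, trivial, ?_⟩
    simp

theorem mem_projDefinable_isQF_iff {A D : Set F} :
    D ∈ ProjDefinable (fun _ φ => φ.IsQF) A ↔ ∃ φ : grpLang.Formula (A ⊕ Fin 1),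
      _root_.IsExistential φ ∧ D = {c | φ.Realize (Sum.elim Subtype.val fun _ => c)} := by
  constructor
  · rintro ⟨k, φ, hφ, rfl⟩
    exact ⟨φ.iExs (Fin k), isExistential_iExs hφ, by simp only [Formula.realize_iExs]⟩
  · rintro ⟨_, ⟨k, ψ, hψ, rfl⟩, rfl⟩
    refine ⟨k, ψ.toFormula, isQF_toFormula hψ, ?_⟩
    simp

end ProjDefinable

/-- Let `F` be a free group of finite rank and `A` a nonabelian subgroup
of `F`. Then `dcl(A)` is a free factor of `acl(A)`; similarly `dcl^∃(A)` is a free factor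
of `acl^∃(A)`. -/
theorem dcl_isFreeFactorOf_acl {F : Type*} [Group F] (hF : IsFreeOfFiniteRank F)
    (A : Subgroup F) (hA : Nonabelian (A : Set F)) :
    IsFreeFactorOf (Subgroup.closure (dcl (A : Set F))) (Subgroup.closure (acl (A : Set F))) ∧
    IsFreeFactorOf (Subgroup.closure (dclE (A : Set F)))
      (Subgroup.closure (aclE (A : Set F))) := by
  constructor
  · convert isFormulaClass_true.isFreeFactorOf hF (A : Set F) using 2
    · ext b
      refine Iff.trans ?_ (mem_projDefinable_true_iff (D := {b})).symm
      exact exists_congr fun φ => eq_comm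
    · ext b
      constructor
      · rintro ⟨φ, hφ, hb⟩
        exact ⟨_, mem_projDefinable_true_iff.2 ⟨φ, rfl⟩, hφ, hb⟩
      · rintro ⟨D, hD, hfin, hb⟩
        obtain ⟨φ, rfl⟩ := mem_projDefinable_true_iff.1 hD
        exact ⟨φ, hfin, hb⟩
  · convert isFormulaClass_isQF.isFreeFactorOf hF (A : Set F) using 2
    · ext b
      refine Iff.trans ?_ (mem_projDefinable_isQF_iff (D := {b})).symm
      exact exists_congr fun φ => and_congr_right fun _ => eq_comm
    · ext b
      constructor
      · rintro ⟨φ, hex, hφ, hb⟩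
        exact ⟨_, mem_projDefinable_isQF_iff.2 ⟨φ, hex, rfl⟩, hφ, hb⟩
      · rintro ⟨D, hD, hfin, hb⟩
        obtain ⟨φ, hex, rfl⟩ := mem_projDefinable_isQF_iff.1 hD
        exact ⟨φ, hex, hfin, hb⟩
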